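/- For every nonempty subset J ⊆ [n+1], the sum Σ_{∅ ≠ I ⊆ J} y_I equals z_J := min over all triangulations T of P of Σ_{j∈J} x_j(T). (Thus the numbers y_I are the dilation coefficients in the Minkowski decomposition of the associahedron conv{x(T)} into dilated faces of the standard simplex.) -/

import Mathlib

attribute [local instance] Classical.propDecidable

noncomputable section

namespace Spines

/-- Position of vertex `v ∈ {0,…,n+2}` in the counterclockwise boundary cyclic order:
`0`, then the elements of `D` in increasing order, then `n+2`, then the elements of `U`
in decreasing order. -/
def pos (n : ℕ) (D U : Finset ℕ) (v : ℕ) : ℕ :=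
  if v = 0 then 0
  else if v = n + 2 then D.card + 1
  else if v ∈ D then 1 + (D.filter (fun d => d < v)).card
  else D.card + 2 + (U.filter (fun u => v < u)).card

/-- Cyclic distance from `a` to `v` in counterclockwise direction. -/
def relpos (n : ℕ) (D U : Finset ℕ) (a v : ℕ) : ℕ :=
  (pos n D U v + (n + 3) - pos n D U a) % (n + 3)

/-- `v` lies strictly inside the counterclockwise boundary arc from `a` to `b`. -/
def StrictBetween (n : ℕ) (D U : Finset ℕ) (a b v : ℕ) : Prop :=
  v ≤ n + 2 ∧ 0 < relpos n D U a v ∧ relpos n D U a v < relpos n D U a b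

/-- A diagonal, encoded as an ordered pair `(a,b)` with `a < b ≤ n+2`. -/
def IsDiag (n : ℕ) (δ : ℕ × ℕ) : Prop := δ.1 < δ.2 ∧ δ.2 ≤ n + 2

/-- A boundary edge: the endpoints are adjacent in the cyclic order. -/
def IsBoundaryEdge (n : ℕ) (D U : Finset ℕ) (δ : ℕ × ℕ) : Prop :=
  IsDiag n δ ∧ (relpos n D U δ.1 δ.2 = 1 ∨ relpos n D U δ.2 δ.1 = 1)

/-- An internal diagonal. -/
def IsInternalDiag (n : ℕ) (D U : Finset ℕ) (δ : ℕ × ℕ) : Prop :=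
  IsDiag n δ ∧ ¬ IsBoundaryEdge n D U δ

/-- Two diagonals cross: the four endpoints are pairwise distinct and exactly one
endpoint of the second lies strictly inside each of the two arcs determined by the first. -/
def Cross (n : ℕ) (D U : Finset ℕ) (δ δ' : ℕ × ℕ) : Prop :=
  δ.1 ≠ δ.2 ∧ δ'.1 ≠ δ'.2 ∧ δ.1 ≠ δ'.1 ∧ δ.1 ≠ δ'.2 ∧ δ.2 ≠ δ'.1 ∧ δ.2 ≠ δ'.2 ∧
  ((StrictBetween n D U δ.1 δ.2 δ'.1 ∧ StrictBetween n D U δ.2 δ.1 δ'.2) ∨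
   (StrictBetween n D U δ.1 δ.2 δ'.2 ∧ StrictBetween n D U δ.2 δ.1 δ'.1))

/-- A triangulation: a maximal set of pairwise non-crossing internal diagonals. -/
def IsTriangulation (n : ℕ) (D U : Finset ℕ) (T : Finset (ℕ × ℕ)) : Prop :=
  (∀ δ ∈ T, IsInternalDiag n D U δ) ∧
  (∀ δ ∈ T, ∀ δ' ∈ T, ¬ Cross n D U δ δ') ∧
  (∀ δ, IsInternalDiag n D U δ → δ ∉ T → ∃ δ' ∈ T, Cross n D U δ δ')

/-- `a` and `b` (with `a < b`) are joined by a diagonal of `T` or a boundary edge. -/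
def EdgeOf (n : ℕ) (D U : Finset ℕ) (T : Finset (ℕ × ℕ)) (a b : ℕ) : Prop :=
  (a, b) ∈ T ∨ IsBoundaryEdge n D U (a, b)

/-- `{i,j,k}` with `i<j<k` is a triangle of the triangulation `T`. -/
def IsTriangleOf (n : ℕ) (D U : Finset ℕ) (T : Finset (ℕ × ℕ)) (i j k : ℕ) : Prop :=
  i < j ∧ j < k ∧ k ≤ n + 2 ∧
    EdgeOf n D U T i j ∧ EdgeOf n D U T j k ∧ EdgeOf n D U T i k

/-- `Bel δ`: labels in `[n+1]` strictly inside the ccw arc from `δ.1` to `δ.2`,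
together with the endpoints of `δ` lying in `U`. -/
def Bel (n : ℕ) (D U : Finset ℕ) (δ : ℕ × ℕ) : Finset ℕ :=
  (Finset.Icc 1 (n + 1)).filter
    (fun j => StrictBetween n D U δ.1 δ.2 j ∨ (j ∈ U ∧ (j = δ.1 ∨ j = δ.2)))

def bel (n : ℕ) (D U : Finset ℕ) (δ : ℕ × ℕ) : ℕ := (Bel n D U δ).card

def Abo (n : ℕ) (D U : Finset ℕ) (δ : ℕ × ℕ) : Finset ℕ :=
  Finset.Icc 1 (n + 1) \ Bel n D U δ

/-- The coordinates of the point `x(T)` associated to a triangulation `T`. -/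
def xcoord (n : ℕ) (D U : Finset ℕ) (T : Finset (ℕ × ℕ)) (j : ℕ) : ℝ :=
  if h : ∃ p : ℕ × ℕ, IsTriangleOf n D U T p.1 j p.2 then
    if j ∈ D then
      ((bel n D U (h.choose.1, j) : ℝ) + 1) * ((bel n D U (j, h.choose.2) : ℝ) + 1)
    else
      ((n : ℝ) + 2) -
        (((n : ℝ) + 2) - (bel n D U (h.choose.1, j) : ℝ)) *
          (((n : ℝ) + 2) - (bel n D U (j, h.choose.2) : ℝ))
  else 0

/-- Middle vertex of the triple `{a,b,c}` with `a < b` and `c ∉ {a,b}`. -/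
def midOf (a b c : ℕ) : ℕ := if c < a then a else if c < b then c else b

/-- `c` is the third vertex of a triangle of `T` containing the diagonal `δ`. -/
def TriWith (n : ℕ) (D U : Finset ℕ) (T : Finset (ℕ × ℕ)) (δ : ℕ × ℕ) (c : ℕ) : Prop :=
  if c < δ.1 then IsTriangleOf n D U T c δ.1 δ.2
  else if c < δ.2 then IsTriangleOf n D U T δ.1 c δ.2
  else IsTriangleOf n D U T δ.1 δ.2 c

/-- `s_δ`: middle vertex of the triangle of `T` below `δ` (third vertex strictly
inside the ccw arc from `δ.1` to `δ.2`). -/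
def spineSrc (n : ℕ) (D U : Finset ℕ) (T : Finset (ℕ × ℕ)) (δ : ℕ × ℕ) : ℕ :=
  if h : ∃ c, StrictBetween n D U δ.1 δ.2 c ∧ TriWith n D U T δ c then
    midOf δ.1 δ.2 h.choose
  else 0

/-- `t_δ`: middle vertex of the triangle of `T` above `δ` (third vertex strictly
inside the ccw arc from `δ.2` to `δ.1`). -/
def spineTgt (n : ℕ) (D U : Finset ℕ) (T : Finset (ℕ × ℕ)) (δ : ℕ × ℕ) : ℕ :=
  if h : ∃ c, StrictBetween n D U δ.2 δ.1 c ∧ TriWith n D U T δ c then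
    midOf δ.1 δ.2 h.choose
  else 0

/-- `(p,q)` is an arc of the spine of `T`. -/
def SpineArc (n : ℕ) (D U : Finset ℕ) (T : Finset (ℕ × ℕ)) (p q : ℕ) : Prop :=
  ∃ δ ∈ T, spineSrc n D U T δ = p ∧ spineTgt n D U T δ = q

/-- The finite set of all triangulations of the polygon. -/
def allTri (n : ℕ) (D U : Finset ℕ) : Finset (Finset (ℕ × ℕ)) :=
  ((Finset.range (n + 3) ×ˢ Finset.range (n + 3)).filter
      (fun δ => IsInternalDiag n D U δ)).powerset.filter
    (fun T => IsTriangulation n D U T)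

end Spines

namespace Spines

/-- Minimum of a finite set of naturals (`0` for the empty set). -/
def minI (I : Finset ℕ) : ℕ := sInf (I : Set ℕ)

/-- Maximum of a finite set of naturals (`0` for the empty set). -/
def maxI (I : Finset ℕ) : ℕ := sSup (I : Set ℕ)

/-- Number of vertices `v ∈ {0,…,n+2}` strictly inside the ccw arc from `a` to `b`. -/
def arcCount (n : ℕ) (D U : Finset ℕ) (a b : ℕ) : ℕ :=
  ((Finset.range (n + 3)).filter (fun v => StrictBetween n D U a b v)).card

/-- A nonempty `I ⊆ [n+1]` is a big top if every `d ∈ D` with `min I < d < max I`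
belongs to `I`. -/
def IsBigTop (n : ℕ) (D : Finset ℕ) (I : Finset ℕ) : Prop :=
  I.Nonempty ∧ I ⊆ Finset.Icc 1 (n + 1) ∧
    ∀ d ∈ D, minI I < d → d < maxI I → d ∈ I

/-- `a(I) = max({0} ∪ {d ∈ D : d < min I})`. -/
def bigA (D : Finset ℕ) (I : Finset ℕ) : ℕ :=
  (insert 0 (D.filter (fun d => d < minI I))).max' (Finset.insert_nonempty _ _)

/-- `b(I) = min({n+2} ∪ {d ∈ D : d > max I})`. -/
def bigB (n : ℕ) (D : Finset ℕ) (I : Finset ℕ) : ℕ :=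
  (insert (n + 2) (D.filter (fun d => maxI I < d))).min' (Finset.insert_nonempty _ _)

/-- `ℓ(I)`: `−1` if `min I ∈ D`, otherwise `1 +` the number of vertices strictly inside
the ccw arc from `min I` to `a(I)`. -/
def ellI (n : ℕ) (D U : Finset ℕ) (I : Finset ℕ) : ℝ :=
  if minI I ∈ D then -1 else 1 + (arcCount n D U (minI I) (bigA D I) : ℝ)

/-- `r(I)`: `−1` if `max I ∈ D`, otherwise `1 +` the number of vertices strictly inside
the ccw arc from `b(I)` to `max I`. -/
def rrI (n : ℕ) (D U : Finset ℕ) (I : Finset ℕ) : ℝ :=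
  if maxI I ∈ D then -1 else 1 + (arcCount n D U (bigB n D I) (maxI I) : ℝ)

/-- The weight `Ω(I) = (−1)^{|I∩U|}·ℓ(I)·r(I)`. -/
def OmegaI (n : ℕ) (D U : Finset ℕ) (I : Finset ℕ) : ℝ :=
  (-1 : ℝ) ^ (I ∩ U).card * ellI n D U I * rrI n D U I

/-- The Minkowski dilation factor `y_I`. -/
def yI (n : ℕ) (D U : Finset ℕ) (I : Finset ℕ) : ℝ :=
  if ¬ IsBigTop n D I then 0
  else if ∃ u ∈ U, I = {u} then OmegaI n D U I + (n : ℝ) + 2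
  else OmegaI n D U I

/-- `D` and `U` partition the label set `[n+1]`. -/
def IsUpDown (n : ℕ) (D U : Finset ℕ) : Prop :=
  D ∪ U = Finset.Icc 1 (n + 1) ∧ Disjoint D U

namespace IsUpDown

variable {n : ℕ} {D U : Finset ℕ}

lemma mem_or (h : IsUpDown n D U) {v : ℕ} : (v ∈ D ∨ v ∈ U) ↔ 1 ≤ v ∧ v ≤ n + 1 := by
  rw [← Finset.mem_union, h.1, Finset.mem_Icc]

lemma not_mem_up (h : IsUpDown n D U) {v : ℕ} (hv : v ∈ D) : v ∉ U :=
  Finset.disjoint_left.1 h.2 hv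

lemma mem_down (h : IsUpDown n D U) {v : ℕ} (h1 : 1 ≤ v) (h2 : v ≤ n + 1) (hv : v ∉ U) :
    v ∈ D := (h.mem_or.2 ⟨h1, h2⟩).resolve_right hv

lemma bounds_up (h : IsUpDown n D U) {v : ℕ} (hv : v ∈ U) : 1 ≤ v ∧ v ≤ n + 1 :=
  h.mem_or.1 (Or.inr hv)

lemma bounds_down (h : IsUpDown n D U) {v : ℕ} (hv : v ∈ D) : 1 ≤ v ∧ v ≤ n + 1 :=
  h.mem_or.1 (Or.inl hv)

lemma card_add_card (h : IsUpDown n D U) : D.card + U.card = n + 1 := by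
  rw [← Finset.card_union_of_disjoint h.2, h.1]; simp

lemma pos_up (h : IsUpDown n D U) {v : ℕ} (hv : v ∈ U) :
    pos n D U v = D.card + 2 + (U.filter (fun u => v < u)).card := by
  have := h.bounds_up hv
  have hd : v ∉ D := fun hd => h.not_mem_up hd hv
  rw [pos, if_neg (by omega), if_neg (by omega), if_neg hd]

lemma pos_down (h : IsUpDown n D U) {v : ℕ} (hv : v ∈ D) :
    pos n D U v = 1 + (D.filter (fun d => d < v)).card := by
  have := h.bounds_down hv
  rw [pos, if_neg (by omega), if_neg (by omega), if_pos hv]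

lemma pos_zero : pos n D U 0 = 0 := by simp [pos]

lemma pos_last : pos n D U (n + 2) = D.card + 1 := by simp [pos]

lemma card_filter_lt {s : Finset ℕ} {p : ℕ → Prop} [DecidablePred p] {v : ℕ} (hv : v ∈ s)
    (hp : ¬ p v) :
    (s.filter p).card < s.card :=
  Finset.card_lt_card ⟨Finset.filter_subset _ _, fun hs => hp (Finset.mem_filter.1 (hs hv)).2⟩

lemma pos_le (h : IsUpDown n D U) {v : ℕ} (hv : v ≤ n + 2) : pos n D U v ≤ n + 2 := by
  have hc := h.card_add_card
  rcases Nat.eq_zero_or_pos v with rfl | h0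
  · simp [pos]
  rcases hv.eq_or_lt with rfl | h1
  · rw [pos_last]; omega
  rcases h.mem_or.2 ⟨h0, by omega⟩ with hd | hu
  · rw [h.pos_down hd]
    have := card_filter_lt (p := fun d => d < v) hd (lt_irrefl v)
    omega
  · rw [h.pos_up hu]
    have := card_filter_lt (p := fun d => v < d) hu (lt_irrefl v)
    omega

lemma pos_le_of_not_mem_up (h : IsUpDown n D U) {v : ℕ} (hv : v ≤ n + 2) (hu : v ∉ U) :
    pos n D U v ≤ D.card + 1 := by
  rcases Nat.eq_zero_or_pos v with rfl | h0
  · simp [pos]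
  rcases hv.eq_or_lt with rfl | h1
  · rw [pos_last]
  have hd := h.mem_down h0 (by omega) hu
  rw [h.pos_down hd]
  have := card_filter_lt (p := fun d => d < v) hd (lt_irrefl v)
  omega

lemma pos_lt_of_up (h : IsUpDown n D U) {v w : ℕ} (hv : v ∈ U) (hw : w ∈ U) (hvw : v < w) :
    pos n D U w < pos n D U v := by
  rw [h.pos_up hv, h.pos_up hw]
  refine Nat.add_lt_add_left (Finset.card_lt_card ⟨fun x hx => ?_, fun hs => ?_⟩) _
  · simp only [Finset.mem_filter] at hx ⊢
    exact ⟨hx.1, hvw.trans hx.2⟩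
  · have := hs (Finset.mem_filter.2 ⟨hw, hvw⟩)
    simp at this

lemma pos_lt_of_not_up (h : IsUpDown n D U) {v w : ℕ} (hv : v ∉ U) (hw : w ∉ U) (hvw : v < w)
    (hw2 : w ≤ n + 2) : pos n D U v < pos n D U w := by
  rcases Nat.eq_zero_or_pos v with rfl | h0
  · rw [pos_zero]
    rcases hw2.eq_or_lt with rfl | h1
    · rw [pos_last]; omega
    · rw [h.pos_down (h.mem_down hvw (by omega) hw)]; omega
  have hvd := h.mem_down h0 (by omega) hv
  rcases hw2.eq_or_lt with rfl | h1
  · rw [pos_last, h.pos_down hvd]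
    have := card_filter_lt (p := fun d => d < v) hvd (lt_irrefl v)
    omega
  · rw [h.pos_down hvd, h.pos_down (h.mem_down (by omega) (by omega) hw)]
    refine Nat.add_lt_add_left (Finset.card_lt_card ⟨fun x hx => ?_, fun hs => ?_⟩) _
    · simp only [Finset.mem_filter] at hx ⊢
      exact ⟨hx.1, hx.2.trans hvw⟩
    · have := hs (Finset.mem_filter.2 ⟨hvd, hvw⟩)
      simp at this

lemma pos_lt_of_mixed (h : IsUpDown n D U) {v w : ℕ} (hv : v ∉ U) (hw : w ∈ U)
    (hv2 : v ≤ n + 2) : pos n D U v < pos n D U w := by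
  have := h.pos_le_of_not_mem_up hv2 hv
  rw [h.pos_up hw]; omega

lemma pos_injOn (h : IsUpDown n D U) : Set.InjOn (pos n D U) (Finset.range (n + 3)) := by
  have key : ∀ v w, v < w → w ≤ n + 2 → pos n D U v ≠ pos n D U w := by
    intro v w hvw hw
    by_cases h1 : v ∈ U <;> by_cases h2 : w ∈ U
    · exact (h.pos_lt_of_up h1 h2 hvw).ne'
    · exact (h.pos_lt_of_mixed h2 h1 hw).ne'
    · exact (h.pos_lt_of_mixed h1 h2 (by omega)).ne
    · exact (h.pos_lt_of_not_up h1 h2 hvw hw).ne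
  intro v hv w hw hvw
  simp only [Finset.coe_range, Set.mem_Iio] at hv hw
  rcases lt_trichotomy v w with hlt | heq | hlt
  · exact absurd hvw (key v w hlt (by omega))
  · exact heq
  · exact absurd hvw.symm (key w v hlt (by omega))

lemma pos_eq_iff (h : IsUpDown n D U) {v w : ℕ} (hv : v ≤ n + 2) (hw : w ≤ n + 2) :
    pos n D U v = pos n D U w ↔ v = w :=
  ⟨fun he => h.pos_injOn (by simp; omega) (by simp; omega) he, fun he => he ▸ rfl⟩

lemma exists_pos_eq (h : IsUpDown n D U) {p : ℕ} (hp : p ≤ n + 2) :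
    ∃ v ≤ n + 2, pos n D U v = p := by
  have hmaps : Set.MapsTo (pos n D U) (Finset.range (n + 3)) (Finset.range (n + 3)) := by
    intro v hv
    simp only [Finset.coe_range, Set.mem_Iio] at hv ⊢
    have := h.pos_le (v := v) (by omega)
    omega
  obtain ⟨v, hv, hvp⟩ := Finset.surjOn_of_injOn_of_card_le (pos n D U) hmaps h.pos_injOn le_rfl
    (show p ∈ (Finset.range (n + 3) : Set ℕ) by simp; omega)
  simp only [Finset.coe_range, Set.mem_Iio] at hv
  exact ⟨v, by omega, hvp⟩

lemma relpos_eq (h : IsUpDown n D U) {a v : ℕ} (ha : a ≤ n + 2) (hv : v ≤ n + 2) :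
    relpos n D U a v = if pos n D U a ≤ pos n D U v then pos n D U v - pos n D U a
      else pos n D U v + (n + 3) - pos n D U a := by
  have h1 := h.pos_le ha
  have h2 := h.pos_le hv
  rw [relpos]
  split_ifs with hle
  · rw [show pos n D U v + (n + 3) - pos n D U a
      = (pos n D U v - pos n D U a) + (n + 3) by omega, Nat.add_mod_right, Nat.mod_eq_of_lt]
    omega
  · rw [Nat.mod_eq_of_lt]; omega

lemma strictBetween_iff_pos (h : IsUpDown n D U) {a b v : ℕ} (ha : a ≤ n + 2) (hb : b ≤ n + 2)
    (hv : v ≤ n + 2) :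
    StrictBetween n D U a b v ↔
      (pos n D U a < pos n D U v ∧ pos n D U v < pos n D U b) ∨
      (pos n D U v < pos n D U b ∧ pos n D U b < pos n D U a) ∨
      (pos n D U b < pos n D U a ∧ pos n D U a < pos n D U v) := by
  have h1 := h.pos_le ha
  have h2 := h.pos_le hb
  have h3 := h.pos_le hv
  rw [StrictBetween, h.relpos_eq ha hv, h.relpos_eq ha hb]
  split_ifs <;> omega

lemma strictBetween_iff (h : IsUpDown n D U) {a b v : ℕ} (hab : a < b) (hb : b ≤ n + 2)
    (hv : v ≤ n + 2) :
    StrictBetween n D U a b v ↔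
      (v ∉ U ∧ a < v ∧ v < b) ∨ (a ∈ U ∧ v < a) ∨ (b ∈ U ∧ b < v) := by
  rw [h.strictBetween_iff_pos (by omega) hb hv]
  have key : ∀ x y, x < y → y ≤ n + 2 → (pos n D U x < pos n D U y ∧ x ∉ U) ∨
      (pos n D U y < pos n D U x ∧ x ∈ U) := by
    intro x y hxy hy
    by_cases h1 : x ∈ U <;> by_cases h2 : y ∈ U
    · exact Or.inr ⟨h.pos_lt_of_up h1 h2 hxy, h1⟩
    · exact Or.inr ⟨h.pos_lt_of_mixed h2 h1 hy, h1⟩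
    · exact Or.inl ⟨h.pos_lt_of_mixed h1 h2 (by omega), h1⟩
    · exact Or.inl ⟨h.pos_lt_of_not_up h1 h2 hxy hy, h1⟩
  have k1 := key a b hab hb
  rcases lt_trichotomy v a with hlt | rfl | hlt
  · have k2 := key v a hlt (by omega)
    have k3 := key v b (by omega) (by omega)
    have e1 : ¬ (a < v) := by omega
    have e2 : ¬ (b < v) := by omega
    by_cases a1 : a ∈ U <;> by_cases a2 : v ∈ U <;> simp_all <;> omega
  · have e2 : ¬ (b < v) := by omega
    simp [e2]; omega
  · rcases lt_trichotomy v b with hlt' | rfl | hlt'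
    · have k2 := key a v hlt (by omega)
      have k3 := key v b hlt' hb
      have e1 : ¬ (v < a) := by omega
      have e2 : ¬ (b < v) := by omega
      by_cases a1 : a ∈ U <;> by_cases a2 : v ∈ U <;> simp_all <;> omega
    · have e1 : ¬ (v < a) := by omega
      simp [e1]; omega
    · have k2 := key a v hlt (by omega)
      have k3 := key b v hlt' (by omega)
      have e1 : ¬ (v < a) := by omega
      have e2 : ¬ (v < b) := by omega
      by_cases a1 : a ∈ U <;> by_cases a2 : b ∈ U <;> simp_all <;> omega

lemma relpos_eq_one_iff (h : IsUpDown n D U) {a b : ℕ} (ha : a ≤ n + 2) (hb : b ≤ n + 2)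
    (hab : a ≠ b) :
    relpos n D U a b = 1 ↔ ∀ v ≤ n + 2, ¬ StrictBetween n D U a b v := by
  have h1 := h.pos_le ha
  have h2 := h.pos_le hb
  have hne := mt (h.pos_eq_iff ha hb).1 hab
  constructor
  · rintro hr v - ⟨-, h3, h4⟩
    omega
  · intro hv
    rw [h.relpos_eq ha hb]
    by_cases hl : pos n D U a = n + 2
    · obtain ⟨v, hv1, hv2⟩ := h.exists_pos_eq (p := 0) (by omega)
      have := hv v hv1
      rw [h.strictBetween_iff_pos ha hb hv1] at this
      split_ifs <;> omega
    · obtain ⟨v, hv1, hv2⟩ := h.exists_pos_eq (p := pos n D U a + 1) (by omega)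
      have := hv v hv1
      rw [h.strictBetween_iff_pos ha hb hv1] at this
      split_ifs <;> omega

end IsUpDown

/-- `a` and `b`, in either order, are joined by a diagonal of `T` or a boundary edge. -/
def Joined (n : ℕ) (D U : Finset ℕ) (T : Finset (ℕ × ℕ)) (a b : ℕ) : Prop :=
  EdgeOf n D U T a b ∨ EdgeOf n D U T b a

section Triangulation

variable {n : ℕ} {D U : Finset ℕ} {T : Finset (ℕ × ℕ)}

lemma Joined.symm {a b : ℕ} (hab : Joined n D U T a b) : Joined n D U T b a := Or.symm hab

namespace IsTriangulation

lemma isDiag_of_edgeOf (hT : IsTriangulation n D U T) {a b : ℕ} (hab : EdgeOf n D U T a b) :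
    a < b ∧ b ≤ n + 2 := by
  rcases hab with hab | hab
  · exact (hT.1 _ hab).1
  · exact hab.1

lemma bounds_of_joined (hT : IsTriangulation n D U T) {a b : ℕ} (hab : Joined n D U T a b) :
    a ≠ b ∧ a ≤ n + 2 ∧ b ≤ n + 2 := by
  rcases hab with hab | hab <;> have := hT.isDiag_of_edgeOf hab <;> omega

lemma edgeOf_of_joined (hT : IsTriangulation n D U T) {a b : ℕ} (hab : Joined n D U T a b)
    (hlt : a < b) : EdgeOf n D U T a b := by
  rcases hab with hab | hab
  · exact hab
  · have := hT.isDiag_of_edgeOf hab; omega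

lemma joined_cases {a b : ℕ} (hab : Joined n D U T a b) :
    relpos n D U a b = 1 ∨ relpos n D U b a = 1 ∨ (a, b) ∈ T ∨ (b, a) ∈ T := by
  rcases hab with (hab | ⟨-, hab⟩) | (hab | ⟨-, hab⟩) <;> tauto

lemma joined_of_relpos {a b : ℕ} (ha : a ≤ n + 2) (hb : b ≤ n + 2) (hne : a ≠ b)
    (hr : relpos n D U a b = 1) : Joined n D U T a b := by
  rcases lt_or_gt_of_ne hne with hlt | hlt
  · exact Or.inl (Or.inr ⟨⟨hlt, hb⟩, Or.inl hr⟩)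
  · exact Or.inr (Or.inr ⟨⟨hlt, ha⟩, Or.inr hr⟩)

lemma not_crossing (hT : IsTriangulation n D U T) (h : IsUpDown n D U) {a b c d : ℕ}
    (hab : Joined n D U T a b) (hcd : Joined n D U T c d)
    (hc : StrictBetween n D U a b c) (hd : StrictBetween n D U b a d) : False := by
  obtain ⟨hne, ha', hb'⟩ := hT.bounds_of_joined hab
  obtain ⟨hne', hc', hd'⟩ := hT.bounds_of_joined hcd
  have hc0 := hc
  have hd0 := hd
  rw [h.strictBetween_iff_pos ha' hb' hc'] at hc0
  rw [h.strictBetween_iff_pos hb' ha' hd'] at hd0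
  have hb2 : StrictBetween n D U c d b := by
    rw [h.strictBetween_iff_pos hc' hd' hb']; omega
  have ha2 : StrictBetween n D U d c a := by
    rw [h.strictBetween_iff_pos hd' hc' ha']; omega
  have n1 : a ≠ c := by rintro rfl; omega
  have n2 : a ≠ d := by rintro rfl; omega
  have n3 : b ≠ c := by rintro rfl; omega
  have n4 : b ≠ d := by rintro rfl; omega
  rcases joined_cases hab with h1 | h1 | h1
  · exact (h.relpos_eq_one_iff ha' hb' hne).1 h1 c hc' hc
  · exact (h.relpos_eq_one_iff hb' ha' hne.symm).1 h1 d hd' hd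
  rcases joined_cases hcd with h2 | h2 | h2
  · exact (h.relpos_eq_one_iff hc' hd' hne').1 h2 b hb' hb2
  · exact (h.relpos_eq_one_iff hd' hc' hne'.symm).1 h2 a ha' ha2
  rcases h1 with h1 | h1 <;> rcases h2 with h2 | h2
  · exact hT.2.1 _ h1 _ h2 ⟨hne, hne', n1, n2, n3, n4, Or.inl ⟨hc, hd⟩⟩
  · exact hT.2.1 _ h1 _ h2 ⟨hne, hne'.symm, n2, n1, n4, n3, Or.inr ⟨hc, hd⟩⟩
  · exact hT.2.1 _ h1 _ h2 ⟨hne.symm, hne', n3, n4, n1, n2, Or.inr ⟨hd, hc⟩⟩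
  · exact hT.2.1 _ h1 _ h2 ⟨hne.symm, hne'.symm, n4, n3, n2, n1, Or.inl ⟨hd, hc⟩⟩

lemma joined_of_forall_not_crossing (hT : IsTriangulation n D U T) {a b : ℕ}
    (ha : a ≤ n + 2) (hb : b ≤ n + 2) (hne : a ≠ b)
    (H : ∀ c d, Joined n D U T c d → StrictBetween n D U a b c →
      StrictBetween n D U b a d → False) : Joined n D U T a b := by
  wlog hlt : a < b generalizing a b
  · exact (this hb ha hne.symm (fun c d hcd h1 h2 => H d c hcd.symm h2 h1) (by omega)).symm
  by_contra hcon
  have hT' : (a, b) ∉ T := fun hm => hcon (Or.inl (Or.inl hm))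
  have hB : ¬ IsBoundaryEdge n D U (a, b) := fun hm => hcon (Or.inl (Or.inr hm))
  obtain ⟨⟨c, d⟩, hmem, -, -, -, -, -, -, hc⟩ := hT.2.2 (a, b) ⟨⟨hlt, hb⟩, hB⟩ hT'
  have hj : Joined n D U T c d := Or.inl (Or.inl hmem)
  rcases hc with ⟨h1, h2⟩ | ⟨h1, h2⟩
  · exact H c d hj h1 h2
  · exact H d c hj.symm h1 h2

/-- Every edge of a triangulation bounds a triangle on each side that contains a vertex. -/
lemma exists_third_vertex (hT : IsTriangulation n D U T) (h : IsUpDown n D U) {a b v : ℕ}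
    (hab : Joined n D U T a b) (hv : StrictBetween n D U a b v) :
    ∃ c, StrictBetween n D U a b c ∧ Joined n D U T a c ∧ Joined n D U T c b := by
  obtain ⟨hne, ha, hb⟩ := hT.bounds_of_joined hab
  let S := (Finset.range (n + 3)).filter
    (fun c => StrictBetween n D U a b c ∧ Joined n D U T a c)
  have pa := h.pos_le ha
  have pb := h.pos_le hb
  have hS : S.Nonempty := by
    have hv' := hv
    rw [h.strictBetween_iff_pos ha hb hv.1] at hv'
    have pv := h.pos_le hv.1
    obtain ⟨c, hc, hpc⟩ := h.exists_pos_eq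
      (p := if pos n D U a = n + 2 then 0 else pos n D U a + 1) (by split_ifs <;> omega)
    have hac : a ≠ c := by rintro rfl; split_ifs at hpc <;> omega
    refine ⟨c, Finset.mem_filter.2 ⟨Finset.mem_range.2 (by omega), ?_, ?_⟩⟩
    · rw [h.strictBetween_iff_pos ha hb hc]; split_ifs at hpc <;> omega
    · refine joined_of_relpos ha hc hac ?_
      rw [h.relpos_eq ha hc]; split_ifs at hpc ⊢ <;> omega
  obtain ⟨c, hcS, hmax⟩ := Finset.exists_max_image S (relpos n D U a) hS
  obtain ⟨-, hc, hac⟩ := Finset.mem_filter.1 hcS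
  have hc' := hc.1
  refine ⟨c, hc, hac, hT.joined_of_forall_not_crossing hc' hb ?_ ?_⟩
  · rintro rfl
    exact lt_irrefl _ hc.2.2
  intro x y hxy hx hy
  have hx' := hx.1
  have hy' := hy.1
  have pc := h.pos_le hc'
  have px := h.pos_le hx'
  have py := h.pos_le hy'
  have hc0 := hc
  rw [h.strictBetween_iff_pos ha hb hc'] at hc0
  have hx0 := hx
  rw [h.strictBetween_iff_pos hc' hb hx'] at hx0
  have hy0 := hy
  rw [h.strictBetween_iff_pos hb hc' hy'] at hy0
  have abx : StrictBetween n D U a b x := by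
    rw [h.strictBetween_iff_pos ha hb hx']; omega
  have cax : StrictBetween n D U c a x := by
    rw [h.strictBetween_iff_pos hc' ha hx']; omega
  have h1 : ¬ StrictBetween n D U b a y := fun hb' => hT.not_crossing h hab hxy abx hb'
  have h2 : ¬ StrictBetween n D U a c y := fun hb' => hT.not_crossing h hac hxy.symm hb' cax
  rw [h.strictBetween_iff_pos hb ha hy'] at h1
  rw [h.strictBetween_iff_pos ha hc' hy'] at h2
  obtain rfl : y = a := (h.pos_eq_iff hy' ha).1 (by omega)
  have := hmax x (Finset.mem_filter.2 ⟨Finset.mem_range.2 (by omega), abx, hxy.symm⟩)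
  rw [h.relpos_eq ha hx', h.relpos_eq ha hc'] at this
  split_ifs at this <;> omega

lemma right_unique (hT : IsTriangulation n D U T) (h : IsUpDown n D U) {i j k i' k' : ℕ}
    (hjk : Joined n D U T j k) (hik : Joined n D U T k i)
    (hjk' : Joined n D U T j k') (hik' : Joined n D U T k' i')
    (c2 : StrictBetween n D U j i' k)
    (c3 : StrictBetween n D U j i k') (c4 : StrictBetween n D U j i' k') : k = k' := by
  obtain ⟨-, bj, bk⟩ := hT.bounds_of_joined hjk
  obtain ⟨-, -, bk'⟩ := hT.bounds_of_joined hjk'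
  obtain ⟨-, -, bi⟩ := hT.bounds_of_joined hik
  obtain ⟨-, -, bi'⟩ := hT.bounds_of_joined hik'
  have n1 : ¬ (StrictBetween n D U j k' k ∧ StrictBetween n D U k' j i) :=
    fun e => hT.not_crossing h hjk' hik e.1 e.2
  have n2 : ¬ (StrictBetween n D U j k k' ∧ StrictBetween n D U k j i') :=
    fun e => hT.not_crossing h hjk hik' e.1 e.2
  rw [← h.pos_eq_iff bk bk']
  rw [h.strictBetween_iff_pos bj bi' bk] at c2
  rw [h.strictBetween_iff_pos bj bi bk'] at c3
  rw [h.strictBetween_iff_pos bj bi' bk'] at c4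
  rw [h.strictBetween_iff_pos bj bk' bk, h.strictBetween_iff_pos bk' bj bi] at n1
  rw [h.strictBetween_iff_pos bj bk bk', h.strictBetween_iff_pos bk bj bi'] at n2
  by_contra hne
  rcases lt_or_gt_of_ne hne with hlt | hlt <;> omega

lemma left_unique (hT : IsTriangulation n D U T) (h : IsUpDown n D U) {i j k i' k' : ℕ}
    (hji : Joined n D U T j i) (hik : Joined n D U T k i)
    (hji' : Joined n D U T j i') (hik' : Joined n D U T k' i')
    (c2 : StrictBetween n D U j i' k)
    (c3 : StrictBetween n D U j i k') (c4 : StrictBetween n D U j i' k') : i = i' := by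
  obtain ⟨-, bj, bi⟩ := hT.bounds_of_joined hji
  obtain ⟨-, -, bi'⟩ := hT.bounds_of_joined hji'
  obtain ⟨-, bk, -⟩ := hT.bounds_of_joined hik
  obtain ⟨-, bk', -⟩ := hT.bounds_of_joined hik'
  have n1 : ¬ (StrictBetween n D U j i k' ∧ StrictBetween n D U i j i') :=
    fun e => hT.not_crossing h hji hik' e.1 e.2
  have n2 : ¬ (StrictBetween n D U j i' k ∧ StrictBetween n D U i' j i) :=
    fun e => hT.not_crossing h hji' hik e.1 e.2
  rw [← h.pos_eq_iff bi bi']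
  rw [h.strictBetween_iff_pos bj bi' bk] at c2
  rw [h.strictBetween_iff_pos bj bi bk'] at c3
  rw [h.strictBetween_iff_pos bj bi' bk'] at c4
  rw [h.strictBetween_iff_pos bj bi bk', h.strictBetween_iff_pos bi bj bi'] at n1
  rw [h.strictBetween_iff_pos bj bi' bk, h.strictBetween_iff_pos bi' bj bi] at n2
  by_contra hne
  rcases lt_or_gt_of_ne hne with hlt | hlt <;> omega

/-- A triangle of a triangulation is determined by its middle vertex. -/
lemma triangle_unique (hT : IsTriangulation n D U T) (h : IsUpDown n D U) {i j k i' k' : ℕ}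
    (ht : IsTriangleOf n D U T i j k) (ht' : IsTriangleOf n D U T i' j k') :
    i = i' ∧ k = k' := by
  obtain ⟨hij, hjk, hk, eij, ejk, eik⟩ := ht
  obtain ⟨hij', hjk', hk', eij', ejk', eik'⟩ := ht'
  have hcyc : ∀ x z, x < j → j < z → z ≤ n + 2 →
      (j ∉ U → StrictBetween n D U j x z) ∧ (j ∈ U → StrictBetween n D U j z x) := by
    intro x z hx hz hz2
    have hx2 : x ≤ n + 2 := by omega
    have hj2 : j ≤ n + 2 := by omega
    have e1 := mt (h.pos_eq_iff hx2 hj2).1 (by omega)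
    have e2 := mt (h.pos_eq_iff hz2 hj2).1 (by omega)
    have e3 := mt (h.pos_eq_iff hx2 hz2).1 (by omega)
    have hs := h.strictBetween_iff (a := x) (b := z) (v := j) (by omega) hz2 hj2
    rw [h.strictBetween_iff_pos hx2 hz2 hj2] at hs
    rw [h.strictBetween_iff_pos hj2 hx2 hz2, h.strictBetween_iff_pos hj2 hz2 hx2]
    constructor
    · intro hj
      have := hs.2 (Or.inl ⟨hj, hx, hz⟩)
      omega
    · intro hj
      have := mt hs.1 (by rintro (h1 | h1 | h1) <;> [exact h1.1 hj; omega; omega])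
      omega
  have c2 := hcyc i' k hij' hjk hk
  have c3 := hcyc i k' hij hjk' hk'
  have c4 := hcyc i' k' hij' hjk' hk'
  by_cases hj : j ∈ U
  · exact ⟨hT.right_unique h (Or.inr eij) (Or.inl eik) (Or.inr eij') (Or.inl eik')
        (c3.2 hj) (c2.2 hj) (c4.2 hj),
      hT.left_unique h (Or.inl ejk) (Or.inl eik) (Or.inl ejk') (Or.inl eik')
        (c3.2 hj) (c2.2 hj) (c4.2 hj)⟩
  · exact ⟨hT.left_unique h (Or.inr eij) (Or.inr eik) (Or.inr eij') (Or.inr eik')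
        (c2.1 hj) (c3.1 hj) (c4.1 hj),
      hT.right_unique h (Or.inl ejk) (Or.inr eik) (Or.inl ejk') (Or.inr eik')
        (c2.1 hj) (c3.1 hj) (c4.1 hj)⟩

end IsTriangulation

end Triangulation

/-- The vertices of the monotone path separating the labels in `J` from the others: the two
extremal vertices, the down labels outside `J` and the up labels in `J`. -/
def blockers (n : ℕ) (D U J : Finset ℕ) : Finset ℕ :=
  insert 0 (insert (n + 2) ((D \ J) ∪ (U ∩ J)))

/-- `i` is the largest blocker of `J` below `j`. -/
def IsPrev (n : ℕ) (D U J : Finset ℕ) (j i : ℕ) : Prop :=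
  i ∈ blockers n D U J ∧ i < j ∧ ∀ c ∈ blockers n D U J, c < j → c ≤ i

/-- `k` is the smallest blocker of `J` above `j`. -/
def IsNext (n : ℕ) (D U J : Finset ℕ) (j k : ℕ) : Prop :=
  k ∈ blockers n D U J ∧ j < k ∧ ∀ c ∈ blockers n D U J, j < c → k ≤ c

/-- The value of a triangle `{i,j,k}` with middle vertex `j`. -/
def gain (n : ℕ) (D U : Finset ℕ) (i j k : ℕ) : ℝ :=
  if j ∈ D then ((bel n D U (i, j) : ℝ) + 1) * ((bel n D U (j, k) : ℝ) + 1)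
  else ((n : ℝ) + 2) -
    (((n : ℝ) + 2) - (bel n D U (i, j) : ℝ)) * (((n : ℝ) + 2) - (bel n D U (j, k) : ℝ))

section Blockers

variable {n : ℕ} {D U J K : Finset ℕ} {T : Finset (ℕ × ℕ)}

lemma mem_blockers {v : ℕ} : v ∈ blockers n D U J ↔
    v = 0 ∨ v = n + 2 ∨ (v ∈ D ∧ v ∉ J) ∨ (v ∈ U ∧ v ∈ J) := by
  simp [blockers]

lemma zero_mem_blockers : 0 ∈ blockers n D U J := by simp [blockers]

lemma last_mem_blockers : n + 2 ∈ blockers n D U J := by simp [blockers]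

lemma exists_isPrev {j : ℕ} (hj : 0 < j) : ∃ i, IsPrev n D U J j i := by
  obtain ⟨i, hi, hmax⟩ := Finset.exists_max_image ((blockers n D U J).filter (fun c => c < j)) id
    ⟨0, Finset.mem_filter.2 ⟨zero_mem_blockers, hj⟩⟩
  rw [Finset.mem_filter] at hi
  exact ⟨i, hi.1, hi.2, fun c hc hcj => hmax c (Finset.mem_filter.2 ⟨hc, hcj⟩)⟩

lemma exists_isNext {j : ℕ} (hj : j < n + 2) : ∃ k, IsNext n D U J j k := by
  obtain ⟨k, hk, hmin⟩ := Finset.exists_min_image ((blockers n D U J).filter (fun c => j < c)) id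
    ⟨n + 2, Finset.mem_filter.2 ⟨last_mem_blockers, hj⟩⟩
  rw [Finset.mem_filter] at hk
  exact ⟨k, hk.1, hk.2, fun c hc hcj => hmin c (Finset.mem_filter.2 ⟨hc, hcj⟩)⟩

namespace IsUpDown

lemma le_of_mem_blockers (h : IsUpDown n D U) {v : ℕ} (hv : v ∈ blockers n D U J) :
    v ≤ n + 2 := by
  rcases mem_blockers.1 hv with h1 | h1 | h1 | h1
  · omega
  · omega
  · have := h.bounds_down h1.1; omega
  · have := h.bounds_up h1.1; omega

lemma mem_bel (h : IsUpDown n D U) {i k j : ℕ} (hik : i < k) (hk : k ≤ n + 2) :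
    j ∈ Bel n D U (i, k) ↔ (1 ≤ j ∧ j ≤ n + 1) ∧
      ((j ∈ D ∧ i < j ∧ j < k) ∨ (i ∈ U ∧ j ≤ i) ∨ (k ∈ U ∧ k ≤ j)) := by
  rw [Bel, Finset.mem_filter, Finset.mem_Icc]
  refine and_congr_right fun hj => ?_
  rw [h.strictBetween_iff hik hk (by omega)]
  have hD : j ∈ D ↔ j ∉ U := ⟨h.not_mem_up, h.mem_down hj.1 hj.2⟩
  rw [hD]
  constructor
  · rintro ((h1 | h1 | h1) | ⟨h1, rfl | rfl⟩)
    · exact Or.inl h1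
    · exact Or.inr (Or.inl ⟨h1.1, h1.2.le⟩)
    · exact Or.inr (Or.inr ⟨h1.1, h1.2.le⟩)
    · exact Or.inr (Or.inl ⟨h1, le_rfl⟩)
    · exact Or.inr (Or.inr ⟨h1, le_rfl⟩)
  · rintro (h1 | ⟨h1, h2⟩ | ⟨h1, h2⟩)
    · exact Or.inl (Or.inl h1)
    · rcases h2.eq_or_lt with rfl | h2
      · exact Or.inr ⟨h1, Or.inl rfl⟩
      · exact Or.inl (Or.inr (Or.inl ⟨h1, h2⟩))
    · rcases h2.eq_or_lt with rfl | h2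
      · exact Or.inr ⟨h1, Or.inr rfl⟩
      · exact Or.inl (Or.inr (Or.inr ⟨h1, h2⟩))

lemma bel_eq (h : IsUpDown n D U) {i k : ℕ} (hik : i < k) (hk : k ≤ n + 2) :
    bel n D U (i, k) = (D.filter (fun d => i < d ∧ d < k)).card +
      (if i ∈ U then i else 0) + (if k ∈ U then n + 2 - k else 0) := by
  have hset : Bel n D U (i, k) = (D.filter (fun d => i < d ∧ d < k)) ∪
      ((if i ∈ U then Finset.Icc 1 i else ∅) ∪ (if k ∈ U then Finset.Icc k (n + 1) else ∅)) := by
    ext j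
    rw [h.mem_bel hik hk]
    simp only [Finset.mem_union, Finset.mem_filter]
    constructor
    · rintro ⟨hj, h1 | h1 | h1⟩
      · exact Or.inl h1
      · exact Or.inr (Or.inl (by simp [h1.1, h1.2, hj.1]))
      · exact Or.inr (Or.inr (by simp [h1.1, h1.2, hj.2]))
    · rintro (h1 | h1 | h1)
      · exact ⟨h.bounds_down h1.1, Or.inl h1⟩
      · split_ifs at h1 with hi
        · rw [Finset.mem_Icc] at h1
          have := h.bounds_up hi
          exact ⟨by omega, Or.inr (Or.inl ⟨hi, h1.2⟩)⟩
        · simp at h1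
      · split_ifs at h1 with hi
        · rw [Finset.mem_Icc] at h1
          have := h.bounds_up hi
          exact ⟨by omega, Or.inr (Or.inr ⟨hi, h1.1⟩)⟩
        · simp at h1
  have hl : ∀ x, x ∈ (if i ∈ U then Finset.Icc 1 i else ∅) → x ≤ i := by
    intro x hx
    split_ifs at hx
    · exact (Finset.mem_Icc.1 hx).2
    · simp at hx
  have hr : ∀ x, x ∈ (if k ∈ U then Finset.Icc k (n + 1) else ∅) → k ≤ x := by
    intro x hx
    split_ifs at hx
    · exact (Finset.mem_Icc.1 hx).1
    · simp at hx
  rw [bel, hset, Finset.card_union_of_disjoint, Finset.card_union_of_disjoint, add_assoc]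
  · congr 2
    · split_ifs <;> simp
    · split_ifs
      · simp
      · simp
  · rw [Finset.disjoint_left]
    intro x hx hx'
    have := hl x hx
    have := hr x hx'
    omega
  · rw [Finset.disjoint_left]
    intro x hx hx'
    have h1 := (Finset.mem_filter.1 hx).2
    rcases Finset.mem_union.1 hx' with h2 | h2
    · have := hl x h2
      omega
    · have := hr x h2
      omega

lemma bel_le (n : ℕ) (D U : Finset ℕ) (δ : ℕ × ℕ) : bel n D U δ ≤ n + 1 := by
  have := Finset.card_filter_le (Finset.Icc 1 (n + 1))
    (fun j => StrictBetween n D U δ.1 δ.2 j ∨ (j ∈ U ∧ (j = δ.1 ∨ j = δ.2)))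
  simpa [bel, Bel] using this

lemma bel_left_mono (h : IsUpDown n D U) (hJK : J ⊆ K) {j i i' : ℕ} (hj : j ≤ n + 2)
    (hi : IsPrev n D U J j i) (hi' : IsPrev n D U K j i') :
    bel n D U (i, j) ≤ bel n D U (i', j) := by
  refine Finset.card_le_card fun x hx => ?_
  rw [h.mem_bel hi.2.1 hj] at hx
  rw [h.mem_bel hi'.2.1 hj]
  refine ⟨hx.1, ?_⟩
  have hmax := hi.2.2 i'
  have hmax' := hi'.2.2 i
  have := hi.2.1
  have := hi'.2.1
  have hb := hi.1
  have hb' := hi'.1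
  rw [mem_blockers] at hmax hmax' hb hb'
  have b1 : i' ∈ D → i' ∉ U := h.not_mem_up
  have b2 : x ∈ D → x ∉ U := h.not_mem_up
  have b3 : i ∈ D → i ∉ U := h.not_mem_up
  have b4 : i ∈ U → 1 ≤ i ∧ i ≤ n + 1 := h.bounds_up
  have b5 : i' ∈ U → 1 ≤ i' ∧ i' ≤ n + 1 := h.bounds_up
  have s1 : i ∈ J → i ∈ K := fun hm => hJK hm
  have s2 : i' ∈ J → i' ∈ K := fun hm => hJK hm
  grind

lemma bel_right_mono (h : IsUpDown n D U) (hJK : J ⊆ K) {j k k' : ℕ}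
    (hk : IsNext n D U J j k) (hk' : IsNext n D U K j k') :
    bel n D U (j, k) ≤ bel n D U (j, k') := by
  have hb := hk.1
  have hb' := hk'.1
  refine Finset.card_le_card fun x hx => ?_
  rw [h.mem_bel hk.2.1 (h.le_of_mem_blockers hb)] at hx
  rw [h.mem_bel hk'.2.1 (h.le_of_mem_blockers hb')]
  refine ⟨hx.1, ?_⟩
  have hmax := hk.2.2 k'
  have hmax' := hk'.2.2 k
  have := hk.2.1
  have := hk'.2.1
  rw [mem_blockers] at hmax hmax' hb hb'
  have b1 : k' ∈ D → k' ∉ U := h.not_mem_up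
  have b2 : x ∈ D → x ∉ U := h.not_mem_up
  have b3 : k ∈ D → k ∉ U := h.not_mem_up
  have b4 : k ∈ U → 1 ≤ k ∧ k ≤ n + 1 := h.bounds_up
  have b5 : k' ∈ U → 1 ≤ k' ∧ k' ≤ n + 1 := h.bounds_up
  have s1 : k ∈ J → k ∈ K := fun hm => hJK hm
  have s2 : k' ∈ J → k' ∈ K := fun hm => hJK hm
  grind

/-- The marginal values increase with the set. -/
lemma gain_mono (h : IsUpDown n D U) (hJK : J ⊆ K) {j i k i' k' : ℕ} (hj : j ≤ n + 2)
    (hi : IsPrev n D U J j i) (hk : IsNext n D U J j k)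
    (hi' : IsPrev n D U K j i') (hk' : IsNext n D U K j k') :
    gain n D U i j k ≤ gain n D U i' j k' := by
  have h1 : (bel n D U (i, j) : ℝ) ≤ bel n D U (i', j) := by
    exact_mod_cast h.bel_left_mono hJK hj hi hi'
  have h2 : (bel n D U (j, k) : ℝ) ≤ bel n D U (j, k') := by
    exact_mod_cast h.bel_right_mono hJK hk hk'
  have h3 : (bel n D U (i', j) : ℝ) ≤ n + 1 := by exact_mod_cast bel_le n D U _
  have h4 : (bel n D U (j, k') : ℝ) ≤ n + 1 := by exact_mod_cast bel_le n D U _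
  rw [gain, gain]
  split_ifs
  · gcongr
  · refine sub_le_sub_left (mul_le_mul ?_ ?_ ?_ ?_) _ <;> linarith

end IsUpDown

lemma IsTriangulation.xcoord_eq (hT : IsTriangulation n D U T) (h : IsUpDown n D U) {i j k : ℕ}
    (ht : IsTriangleOf n D U T i j k) : xcoord n D U T j = gain n D U i j k := by
  have hex : ∃ p : ℕ × ℕ, IsTriangleOf n D U T p.1 j p.2 := ⟨(i, k), ht⟩
  obtain ⟨h1, h2⟩ := hT.triangle_unique h hex.choose_spec ht
  rw [xcoord, dif_pos hex, h1, h2, gain]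

end Blockers

/-- Inclusion-exclusion: signed sum over the subsets of `s` that contain `E`. -/
lemma sum_powerset_sign {s E U : Finset ℕ} (hEU : Disjoint E U) (hs : s \ U ⊆ E) :
    ∑ A ∈ s.powerset, (if E ⊆ A then (-1 : ℝ) ^ (A ∩ U).card else 0) =
      if E ⊆ s ∧ s ∩ U = ∅ then 1 else 0 := by
  by_cases hU : s ∩ U = ∅
  · by_cases hE : E ⊆ s
    · rw [if_pos ⟨hE, hU⟩, Finset.sum_eq_single s]
      · simp [hE, hU]
      · intro A hA hne
        refine if_neg fun hEA => hne ?_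
        refine Finset.Subset.antisymm (Finset.mem_powerset.1 hA) fun x hx => hEA (hs ?_)
        refine Finset.mem_sdiff.2 ⟨hx, fun hxU => ?_⟩
        have : x ∈ s ∩ U := Finset.mem_inter.2 ⟨hx, hxU⟩
        simp [hU] at this
      · intro hns
        exact absurd (Finset.mem_powerset_self s) hns
    · rw [if_neg (fun hc => hE hc.1)]
      exact Finset.sum_eq_zero fun A hA =>
        if_neg fun hEA => hE (hEA.trans (Finset.mem_powerset.1 hA))
  · rw [if_neg (fun hc => hU hc.2)]
    obtain ⟨u, hu⟩ := Finset.nonempty_iff_ne_empty.2 hU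
    obtain ⟨hus, huU⟩ := Finset.mem_inter.1 hu
    rw [← Finset.insert_erase hus, Finset.sum_powerset_insert (Finset.notMem_erase u s),
      ← Finset.sum_add_distrib]
    refine Finset.sum_eq_zero fun A hA => ?_
    have huA : u ∉ A := fun hm => Finset.notMem_erase u s (Finset.mem_powerset.1 hA hm)
    have huE : u ∉ E := fun hm => Finset.disjoint_left.1 hEU hm huU
    simp only [Finset.subset_insert_iff_of_notMem huE, Finset.insert_inter_of_mem huU,
      Finset.card_insert_of_notMem (fun hm => huA (Finset.mem_inter.1 hm).1)]
    split_ifs <;> ring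

lemma minI_eq {I : Finset ℕ} {m : ℕ} (hm : m ∈ I) (hle : ∀ x ∈ I, m ≤ x) : minI I = m :=
  IsLeast.csInf_eq ⟨hm, fun x hx => hle x hx⟩

lemma maxI_eq {I : Finset ℕ} {m : ℕ} (hm : m ∈ I) (hle : ∀ x ∈ I, x ≤ m) : maxI I = m :=
  IsGreatest.csSup_eq ⟨hm, fun x hx => hle x hx⟩

lemma minI_mem {I : Finset ℕ} (hI : I.Nonempty) : minI I ∈ I ∧ ∀ x ∈ I, minI I ≤ x := by
  rw [minI_eq (I.min'_mem hI) (fun x hx => I.min'_le x hx)]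
  exact ⟨I.min'_mem hI, fun x hx => I.min'_le x hx⟩

lemma maxI_mem {I : Finset ℕ} (hI : I.Nonempty) : maxI I ∈ I ∧ ∀ x ∈ I, x ≤ maxI I := by
  rw [maxI_eq (I.max'_mem hI) (fun x hx => I.le_max' x hx)]
  exact ⟨I.max'_mem hI, fun x hx => I.le_max' x hx⟩

/-- The value of `ℓ` in terms of the minimum. -/
def ellVal (D : Finset ℕ) (p : ℕ) : ℝ := if p ∈ D then -1 else p

/-- The value of `r` in terms of the maximum. -/
def rVal (n : ℕ) (D : Finset ℕ) (q : ℕ) : ℝ := if q ∈ D then -1 else (n : ℝ) + 2 - q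

/-- The contribution to `Ω` of the part `A` of a big top lying below one of its labels `j`. -/
def leftWeight (D U : Finset ℕ) (j : ℕ) (A : Finset ℕ) : ℝ :=
  if A.Nonempty ∧ ∀ d ∈ D, minI A < d → d < j → d ∈ A then
    -(-1) ^ (A ∩ U).card * ellVal D (minI A) else 0

/-- The contribution to `Ω` of the part `B` of a big top lying above one of its labels `j`. -/
def rightWeight (n : ℕ) (D U : Finset ℕ) (j : ℕ) (B : Finset ℕ) : ℝ :=
  if B.Nonempty ∧ ∀ d ∈ D, j < d → d < maxI B → d ∈ B then
    -(-1) ^ (B ∩ U).card * rVal n D (maxI B) else 0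

namespace IsUpDown

variable {n : ℕ} {D U J : Finset ℕ}

lemma strictBetween_swap (h : IsUpDown n D U) {a b v : ℕ} (ha : a ≤ n + 2) (hb : b ≤ n + 2)
    (hv : v ≤ n + 2) (hab : a ≠ b) :
    StrictBetween n D U b a v ↔ v ≠ a ∧ v ≠ b ∧ ¬ StrictBetween n D U a b v := by
  rw [h.strictBetween_iff_pos hb ha hv, h.strictBetween_iff_pos ha hb hv, Ne, Ne,
    ← h.pos_eq_iff hv ha, ← h.pos_eq_iff hv hb]
  have := mt (h.pos_eq_iff ha hb).1 hab
  omega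

lemma ellI_eq (h : IsUpDown n D U) {I : Finset ℕ} (hI : minI I ∈ Finset.Icc 1 (n + 1)) :
    ellI n D U I = ellVal D (minI I) := by
  rw [ellI, ellVal]
  split_ifs with hd
  · rfl
  rw [Finset.mem_Icc] at hI
  have hu : minI I ∈ U := (h.mem_or.2 hI).resolve_left hd
  have hmem := Finset.max'_mem (insert 0 (D.filter (fun d => d < minI I)))
    (Finset.insert_nonempty _ _)
  have hmax := Finset.le_max' (insert 0 (D.filter (fun d => d < minI I)))
  change bigA D I ∈ _ at hmem
  change ∀ x (hx : _), x ≤ bigA D I at hmax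
  simp only [Finset.mem_insert, Finset.mem_filter] at hmem hmax
  have ha : bigA D I < minI I := by omega
  have haU : bigA D I ∉ U := by
    rcases hmem with h0 | h0
    · intro hm; have := h.bounds_up hm; omega
    · exact h.not_mem_up h0.1
  have : (Finset.range (n + 3)).filter (fun v => StrictBetween n D U (minI I) (bigA D I) v) =
      (Finset.range (minI I)).erase (bigA D I) := by
    ext v
    rw [Finset.mem_filter, Finset.mem_range, Finset.mem_erase, Finset.mem_range]
    by_cases hv : v < n + 3
    · rw [h.strictBetween_swap (by omega) (by omega) (by omega) (by omega),
        h.strictBetween_iff ha (by omega) (by omega)]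
      have hD : v ∉ U → bigA D I < v → v < minI I → False := fun h1 h2 h3 => by
        have := hmax v (Or.inr ⟨h.mem_down (by omega) (by omega) h1, h3⟩)
        omega
      simp only [haU, hu, false_and, true_and, false_or, hv]
      constructor
      · rintro ⟨h1, h2, h3⟩
        push Not at h3
        exact ⟨h1, by omega⟩
      · rintro ⟨h1, h2⟩
        refine ⟨h1, by omega, ?_⟩
        rintro (⟨h3, h4, h5⟩ | h3)
        · exact hD h3 h4 h5
        · omega
    · constructor
      · rintro ⟨h1, -⟩; omega
      · rintro ⟨-, h1⟩; omega
  rw [arcCount, this, Finset.card_erase_of_mem (Finset.mem_range.2 ha), Finset.card_range,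
    Nat.cast_sub hI.1]
  simp

lemma rrI_eq (h : IsUpDown n D U) {I : Finset ℕ} (hI : maxI I ∈ Finset.Icc 1 (n + 1)) :
    rrI n D U I = rVal n D (maxI I) := by
  rw [rrI, rVal]
  split_ifs with hd
  · rfl
  rw [Finset.mem_Icc] at hI
  have hu : maxI I ∈ U := (h.mem_or.2 hI).resolve_left hd
  have hmem := Finset.min'_mem (insert (n + 2) (D.filter (fun d => maxI I < d)))
    (Finset.insert_nonempty _ _)
  have hmin := Finset.min'_le (insert (n + 2) (D.filter (fun d => maxI I < d)))
  change bigB n D I ∈ _ at hmem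
  change ∀ x (hx : _), bigB n D I ≤ x at hmin
  simp only [Finset.mem_insert, Finset.mem_filter] at hmem hmin
  have hb : maxI I < bigB n D I := by omega
  have hbU : bigB n D I ∉ U := by
    rcases hmem with h0 | h0
    · intro hm; have := h.bounds_up hm; omega
    · exact h.not_mem_up h0.1
  have hb2 : bigB n D I ≤ n + 2 := hmin _ (Or.inl rfl)
  have : (Finset.range (n + 3)).filter (fun v => StrictBetween n D U (bigB n D I) (maxI I) v) =
      (Finset.Ioc (maxI I) (n + 2)).erase (bigB n D I) := by
    ext v
    rw [Finset.mem_filter, Finset.mem_range, Finset.mem_erase, Finset.mem_Ioc]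
    by_cases hv : v < n + 3
    · rw [h.strictBetween_swap (by omega) (by omega) (by omega) (by omega),
        h.strictBetween_iff hb (by omega) (by omega)]
      have hD : v ∉ U → maxI I < v → v < bigB n D I → False := fun h1 h2 h3 => by
        have := hmin v (Or.inr ⟨h.mem_down (by omega) (by omega) h1, h2⟩)
        omega
      simp only [hbU, hu, false_and, true_and, or_false, hv]
      constructor
      · rintro ⟨h1, h2, h3⟩
        push Not at h3
        exact ⟨h2, by omega, by omega⟩
      · rintro ⟨h1, h2⟩
        refine ⟨by omega, h1, ?_⟩
        rintro (⟨h3, h4, h5⟩ | h3)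
        · exact hD h3 h4 h5
        · omega
    · constructor
      · rintro ⟨h1, -⟩; omega
      · rintro ⟨-, h1⟩; omega
  rw [arcCount, this, Finset.card_erase_of_mem (Finset.mem_Ioc.2 ⟨hb, hb2⟩), Nat.card_Ioc,
    Nat.cast_sub (by omega), Nat.cast_sub (by omega)]
  push_cast
  ring

lemma isBigTop_insert_iff {A B : Finset ℕ} {j : ℕ}
    (hA : A ⊆ Finset.Icc 1 (n + 1)) (hB : B ⊆ Finset.Icc 1 (n + 1))
    (hj : j ∈ Finset.Icc 1 (n + 1)) (hAj : ∀ x ∈ A, x < j) (hBj : ∀ x ∈ B, j < x) :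
    minI (insert j (A ∪ B)) = (if A = ∅ then j else minI A) ∧
    maxI (insert j (A ∪ B)) = (if B = ∅ then j else maxI B) ∧
    (IsBigTop n D (insert j (A ∪ B)) ↔
      (A = ∅ ∨ ∀ d ∈ D, minI A < d → d < j → d ∈ A) ∧
      (B = ∅ ∨ ∀ d ∈ D, j < d → d < maxI B → d ∈ B)) := by
  have hmin : minI (insert j (A ∪ B)) = if A = ∅ then j else minI A := by
    split_ifs with h0
    · subst h0
      refine minI_eq (by simp) fun x hx => ?_
      simp only [Finset.empty_union, Finset.mem_insert] at hx
      rcases hx with rfl | hx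
      · exact le_rfl
      · exact (hBj x hx).le
    · obtain ⟨h1, h2⟩ := minI_mem (Finset.nonempty_iff_ne_empty.2 h0)
      refine minI_eq (by simp [h1]) fun x hx => ?_
      simp only [Finset.mem_union, Finset.mem_insert] at hx
      have := hAj _ h1
      rcases hx with rfl | hx | hx
      · exact this.le
      · exact h2 x hx
      · have := hBj x hx; omega
  have hmax : maxI (insert j (A ∪ B)) = if B = ∅ then j else maxI B := by
    split_ifs with h0
    · subst h0
      refine maxI_eq (by simp) fun x hx => ?_
      simp only [Finset.union_empty, Finset.mem_insert] at hx
      rcases hx with rfl | hx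
      · exact le_rfl
      · exact (hAj x hx).le
    · obtain ⟨h1, h2⟩ := maxI_mem (Finset.nonempty_iff_ne_empty.2 h0)
      refine maxI_eq (by simp [h1]) fun x hx => ?_
      simp only [Finset.mem_union, Finset.mem_insert] at hx
      have := hBj _ h1
      rcases hx with rfl | hx | hx
      · exact this.le
      · have := hAj x hx; omega
      · exact h2 x hx
  refine ⟨hmin, hmax, ?_⟩
  have hsub : insert j (A ∪ B) ⊆ Finset.Icc 1 (n + 1) :=
    Finset.insert_subset hj (Finset.union_subset hA hB)
  rw [IsBigTop, hmin, hmax]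
  simp only [Finset.insert_nonempty, hsub, true_and, Finset.mem_insert, Finset.mem_union]
  have mA : A ≠ ∅ → minI A < j := fun h0 => hAj _ (minI_mem (Finset.nonempty_iff_ne_empty.2 h0)).1
  have mB : B ≠ ∅ → j < maxI B := fun h0 => hBj _ (maxI_mem (Finset.nonempty_iff_ne_empty.2 h0)).1
  constructor
  · intro H
    constructor
    · rw [or_iff_not_imp_left]
      intro h0 d hd h1 h2
      have hd' := H d hd
      rw [if_neg h0] at hd'
      rcases hd' h1 (by split_ifs with h3 <;> [exact h2; exact h2.trans (mB h3)]) with h4 | h4 | h4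
      · omega
      · exact h4
      · have := hBj d h4; omega
    · rw [or_iff_not_imp_left]
      intro h0 d hd h1 h2
      have hd' := H d hd
      rw [if_neg h0] at hd'
      rcases hd' (by split_ifs with h3 <;> [exact h1; exact (mA h3).trans h1]) h2 with h4 | h4 | h4
      · omega
      · have := hAj d h4; omega
      · exact h4
  · rintro ⟨H1, H2⟩ d hd h1 h2
    rcases lt_trichotomy d j with h3 | h3 | h3
    · rcases H1 with h4 | h4
      · rw [if_pos h4] at h1; omega
      · by_cases h5 : A = ∅
        · rw [if_pos h5] at h1; omega
        · rw [if_neg h5] at h1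
          exact Or.inr (Or.inl (h4 d hd h1 h3))
    · exact Or.inl h3
    · rcases H2 with h4 | h4
      · rw [if_pos h4] at h2; omega
      · by_cases h5 : B = ∅
        · rw [if_pos h5] at h2; omega
        · rw [if_neg h5] at h2
          exact Or.inr (Or.inr (h4 d hd h3 h2))

/-- Factorization of `y_I` along a label `j ∈ I`. -/
lemma yI_insert (h : IsUpDown n D U) {A B : Finset ℕ} {j : ℕ}
    (hA : A ⊆ Finset.Icc 1 (n + 1)) (hB : B ⊆ Finset.Icc 1 (n + 1))
    (hj : j ∈ Finset.Icc 1 (n + 1)) (hAj : ∀ x ∈ A, x < j) (hBj : ∀ x ∈ B, j < x) :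
    yI n D U (insert j (A ∪ B)) =
      if j ∈ D then ((if A = ∅ then 1 else 0) + leftWeight D U j A) *
        ((if B = ∅ then 1 else 0) + rightWeight n D U j B)
      else ((n : ℝ) + 2) * ((if A = ∅ then 1 else 0) * (if B = ∅ then 1 else 0)) -
        (j * (if A = ∅ then 1 else 0) - leftWeight D U j A) *
        (((n : ℝ) + 2 - j) * (if B = ∅ then 1 else 0) - rightWeight n D U j B) := by
  obtain ⟨hmin, hmax, hbig⟩ := isBigTop_insert_iff (D := D) hA hB hj hAj hBj
  have hsub : insert j (A ∪ B) ⊆ Finset.Icc 1 (n + 1) :=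
    Finset.insert_subset hj (Finset.union_subset hA hB)
  have hne : (insert j (A ∪ B)).Nonempty := Finset.insert_nonempty _ _
  have hjA : j ∉ A := fun hm => lt_irrefl _ (hAj j hm)
  have hjB : j ∉ B := fun hm => lt_irrefl _ (hBj j hm)
  have hAB : Disjoint A B := Finset.disjoint_left.2 fun x h1 h2 => by
    have := hAj x h1; have := hBj x h2; omega
  have hcard : (insert j (A ∪ B) ∩ U).card =
      (A ∩ U).card + (B ∩ U).card + if j ∈ D then 0 else 1 := by
    have h1 : ((A ∪ B) ∩ U).card = (A ∩ U).card + (B ∩ U).card := by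
      rw [Finset.union_inter_distrib_right, Finset.card_union_of_disjoint]
      exact hAB.mono Finset.inter_subset_left Finset.inter_subset_left
    split_ifs with hd
    · rw [Finset.insert_inter_of_notMem (h.not_mem_up hd), h1, add_zero]
    · have hu : j ∈ U := (h.mem_or.2 (Finset.mem_Icc.1 hj)).resolve_left hd
      rw [Finset.insert_inter_of_mem hu, Finset.card_insert_of_notMem, h1]
      simp [hjA, hjB]
  have hsing : (∃ u ∈ U, insert j (A ∪ B) = {u}) ↔ j ∉ D ∧ A = ∅ ∧ B = ∅ := by
    constructor
    · rintro ⟨u, hu, he⟩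
      have hju : j = u := by
        have : j ∈ ({u} : Finset ℕ) := he ▸ Finset.mem_insert_self _ _
        simpa using this
      subst hju
      refine ⟨fun hd => h.not_mem_up hd hu, ?_, ?_⟩
      · refine Finset.eq_empty_of_forall_notMem fun x hx => ?_
        have hm : x ∈ ({j} : Finset ℕ) := he ▸ by simp [hx]
        rw [Finset.mem_singleton] at hm
        exact hjA (hm ▸ hx)
      · refine Finset.eq_empty_of_forall_notMem fun x hx => ?_
        have hm : x ∈ ({j} : Finset ℕ) := he ▸ by simp [hx]
        rw [Finset.mem_singleton] at hm
        exact hjB (hm ▸ hx)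
    · rintro ⟨hd, rfl, rfl⟩
      exact ⟨j, (h.mem_or.2 (Finset.mem_Icc.1 hj)).resolve_left hd, by simp⟩
  rw [yI, OmegaI, h.ellI_eq (hsub (minI_mem hne).1), h.rrI_eq (hsub (maxI_mem hne).1), hmin, hmax,
    hcard, leftWeight, rightWeight]
  simp only [hbig, hsing, Finset.nonempty_iff_ne_empty]
  obtain ⟨P, hP⟩ : ∃ P : Prop, P = ∀ d ∈ D, minI A < d → d < j → d ∈ A := ⟨_, rfl⟩
  obtain ⟨Q, hQ⟩ : ∃ Q : Prop, Q = ∀ d ∈ D, j < d → d < maxI B → d ∈ B := ⟨_, rfl⟩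
  simp only [← hP, ← hQ]
  clear hP hQ
  have hl : ellVal D j = if j ∈ D then -1 else (j : ℝ) := rfl
  have hr : rVal n D j = if j ∈ D then -1 else (n : ℝ) + 2 - j := rfl
  by_cases hd : j ∈ D <;> by_cases hA0 : A = ∅ <;> by_cases hB0 : B = ∅ <;> by_cases hP : P <;>
    by_cases hQ : Q <;> simp [hd, hA0, hB0, hP, hQ, hl, hr, pow_add] <;> ring

end IsUpDown

namespace IsUpDown

variable {n : ℕ} {D U J : Finset ℕ}

lemma leftWeight_insert (h : IsUpDown n D U) {A : Finset ℕ} {a j : ℕ}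
    (ha : a ∈ Finset.Icc 1 (n + 1)) (hA : ∀ x ∈ A, a < x) :
    leftWeight D U j (insert a A) = (if a ∈ D then 1 else (a : ℝ)) *
      (if D.filter (fun d => a < d ∧ d < j) ⊆ A then (-1 : ℝ) ^ (A ∩ U).card else 0) := by
  have hmin : minI (insert a A) = a := minI_eq (Finset.mem_insert_self _ _) fun x hx => by
    rcases Finset.mem_insert.1 hx with rfl | hx
    · exact le_rfl
    · exact (hA x hx).le
  have hcond : (∀ d ∈ D, a < d → d < j → d ∈ insert a A) ↔
      D.filter (fun d => a < d ∧ d < j) ⊆ A := by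
    constructor
    · intro H d hd
      rw [Finset.mem_filter] at hd
      exact Finset.mem_of_mem_insert_of_ne (H d hd.1 hd.2.1 hd.2.2) hd.2.1.ne'
    · intro H d hd h1 h2
      exact Finset.mem_insert_of_mem (H (Finset.mem_filter.2 ⟨hd, h1, h2⟩))
  have haA : a ∉ A := fun hm => lt_irrefl _ (hA a hm)
  rw [leftWeight, hmin, ellVal]
  simp only [hcond, Finset.insert_nonempty, true_and]
  by_cases hd : a ∈ D
  · rw [Finset.insert_inter_of_notMem (h.not_mem_up hd)]
    simp [hd]
  · have hu : a ∈ U := (h.mem_or.2 (Finset.mem_Icc.1 ha)).resolve_left hd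
    rw [Finset.insert_inter_of_mem hu, Finset.card_insert_of_notMem (by simp [haA])]
    simp only [hd, if_false]
    split_ifs <;> ring

lemma rightWeight_insert (h : IsUpDown n D U) {A : Finset ℕ} {a j : ℕ}
    (ha : a ∈ Finset.Icc 1 (n + 1)) (hA : ∀ x ∈ A, x < a) :
    rightWeight n D U j (insert a A) = (if a ∈ D then 1 else (n : ℝ) + 2 - a) *
      (if D.filter (fun d => j < d ∧ d < a) ⊆ A then (-1 : ℝ) ^ (A ∩ U).card else 0) := by
  have hmax : maxI (insert a A) = a := maxI_eq (Finset.mem_insert_self _ _) fun x hx => by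
    rcases Finset.mem_insert.1 hx with rfl | hx
    · exact le_rfl
    · exact (hA x hx).le
  have hcond : (∀ d ∈ D, j < d → d < a → d ∈ insert a A) ↔
      D.filter (fun d => j < d ∧ d < a) ⊆ A := by
    constructor
    · intro H d hd
      rw [Finset.mem_filter] at hd
      exact Finset.mem_of_mem_insert_of_ne (H d hd.1 hd.2.1 hd.2.2) hd.2.2.ne
    · intro H d hd h1 h2
      exact Finset.mem_insert_of_mem (H (Finset.mem_filter.2 ⟨hd, h1, h2⟩))
  have haA : a ∉ A := fun hm => lt_irrefl _ (hA a hm)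
  rw [rightWeight, hmax, rVal]
  simp only [hcond, Finset.insert_nonempty, true_and]
  by_cases hd : a ∈ D
  · rw [Finset.insert_inter_of_notMem (h.not_mem_up hd)]
    simp [hd]
  · have hu : a ∈ U := (h.mem_or.2 (Finset.mem_Icc.1 ha)).resolve_left hd
    rw [Finset.insert_inter_of_mem hu, Finset.card_insert_of_notMem (by simp [haA])]
    simp only [hd, if_false]
    split_ifs <;> ring

lemma sum_leftWeight_powerset (h : IsUpDown n D U) (j : ℕ) (M : Finset ℕ)
    (hM : M ⊆ Finset.Icc 1 (n + 1)) (hMj : ∀ x ∈ M, x < j) :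
    ∑ A ∈ M.powerset, leftWeight D U j A = ∑ p ∈ M, (if p ∈ D then 1 else (p : ℝ)) *
      (if D.filter (fun d => p < d ∧ d < j) ⊆ M.filter (fun x => p < x) ∧
        M.filter (fun x => p < x) ∩ U = ∅ then 1 else 0) := by
  induction M using Finset.induction_on_min with
  | empty => simp [leftWeight]
  | insert a s has ih =>
    have hanot : a ∉ s := fun hm => lt_irrefl _ (has a hm)
    have hself : (insert a s).filter (fun x => a < x) = s := by
      ext x
      simp only [Finset.mem_filter, Finset.mem_insert]
      constructor
      · rintro ⟨rfl | hx, h1⟩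
        · omega
        · exact hx
      · exact fun hx => ⟨Or.inr hx, has x hx⟩
    have hother : ∀ p ∈ s, (insert a s).filter (fun x => p < x) = s.filter (fun x => p < x) :=
      fun p hp => by
        rw [Finset.filter_insert, if_neg]
        have := has p hp
        omega
    have hsM : s ⊆ Finset.Icc 1 (n + 1) := (Finset.subset_insert a s).trans hM
    rw [Finset.sum_powerset_insert hanot, Finset.sum_insert hanot, hself, add_comm,
      ih hsM (fun x hx => hMj x (Finset.mem_insert_of_mem hx))]
    congr 1
    · rw [← sum_powerset_sign, Finset.mul_sum]
      · refine Finset.sum_congr rfl fun A hA => ?_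
        exact h.leftWeight_insert (hM (Finset.mem_insert_self _ _))
          fun x hx => has x (Finset.mem_powerset.1 hA hx)
      · exact Finset.disjoint_left.2 fun x hx => h.not_mem_up (Finset.mem_filter.1 hx).1
      · intro x hx
        rw [Finset.mem_sdiff] at hx
        have hb := Finset.mem_Icc.1 (hsM hx.1)
        exact Finset.mem_filter.2 ⟨h.mem_down hb.1 hb.2 hx.2, has x hx.1,
          hMj x (Finset.mem_insert_of_mem hx.1)⟩
    · exact Finset.sum_congr rfl fun p hp => by rw [hother p hp]

lemma sum_rightWeight_powerset (h : IsUpDown n D U) (j : ℕ) (M : Finset ℕ)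
    (hM : M ⊆ Finset.Icc 1 (n + 1)) (hMj : ∀ x ∈ M, j < x) :
    ∑ A ∈ M.powerset, rightWeight n D U j A = ∑ p ∈ M, (if p ∈ D then 1 else (n : ℝ) + 2 - p) *
      (if D.filter (fun d => j < d ∧ d < p) ⊆ M.filter (fun x => x < p) ∧
        M.filter (fun x => x < p) ∩ U = ∅ then 1 else 0) := by
  induction M using Finset.induction_on_max with
  | empty => simp [rightWeight]
  | insert a s has ih =>
    have hanot : a ∉ s := fun hm => lt_irrefl _ (has a hm)
    have hself : (insert a s).filter (fun x => x < a) = s := by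
      ext x
      simp only [Finset.mem_filter, Finset.mem_insert]
      constructor
      · rintro ⟨rfl | hx, h1⟩
        · omega
        · exact hx
      · exact fun hx => ⟨Or.inr hx, has x hx⟩
    have hother : ∀ p ∈ s, (insert a s).filter (fun x => x < p) = s.filter (fun x => x < p) :=
      fun p hp => by
        rw [Finset.filter_insert, if_neg]
        have := has p hp
        omega
    have hsM : s ⊆ Finset.Icc 1 (n + 1) := (Finset.subset_insert a s).trans hM
    rw [Finset.sum_powerset_insert hanot, Finset.sum_insert hanot, hself, add_comm,
      ih hsM (fun x hx => hMj x (Finset.mem_insert_of_mem hx))]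
    congr 1
    · rw [← sum_powerset_sign, Finset.mul_sum]
      · refine Finset.sum_congr rfl fun A hA => ?_
        exact h.rightWeight_insert (hM (Finset.mem_insert_self _ _))
          fun x hx => has x (Finset.mem_powerset.1 hA hx)
      · exact Finset.disjoint_left.2 fun x hx => h.not_mem_up (Finset.mem_filter.1 hx).1
      · intro x hx
        rw [Finset.mem_sdiff] at hx
        have hb := Finset.mem_Icc.1 (hsM hx.1)
        exact Finset.mem_filter.2 ⟨h.mem_down hb.1 hb.2 hx.2,
          hMj x (Finset.mem_insert_of_mem hx.1), has x hx.1⟩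
    · exact Finset.sum_congr rfl fun p hp => by rw [hother p hp]

lemma sum_leftWeight (h : IsUpDown n D U) (hJ : J ⊆ Finset.Icc 1 (n + 1)) {i j : ℕ}
    (hj : j ∈ Finset.Icc 1 (n + 1)) (hi : IsPrev n D U J j i) :
    ∑ A ∈ (J.filter (fun x => x < j)).powerset, leftWeight D U j A =
      (D.filter (fun d => i < d ∧ d < j)).card + if i ∈ U then (i : ℝ) else 0 := by
  rw [h.sum_leftWeight_powerset j _ ((Finset.filter_subset _ _).trans hJ)
    (fun x hx => (Finset.mem_filter.1 hx).2)]
  simp only [mul_ite, mul_one, mul_zero]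
  rw [← Finset.sum_filter]
  obtain ⟨hib, hij, hmax⟩ := hi
  rw [Finset.mem_Icc] at hj
  rw [mem_blockers] at hib
  have key : ∀ c, c ∈ Finset.Icc 1 (n + 1) → i < c → c < j → (c ∈ J ↔ c ∈ D) ∧ (c ∈ J → c ∉ U) := by
    intro c hc h1 h2
    have := hmax c
    rw [mem_blockers] at this
    have h3 : ¬ ((c ∈ D ∧ c ∉ J) ∨ (c ∈ U ∧ c ∈ J)) := fun h4 => by
      have := this (Or.inr (Or.inr h4)) h2
      omega
    have h5 := h.mem_or.2 (Finset.mem_Icc.1 hc)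
    have h6 : c ∈ D → c ∉ U := h.not_mem_up
    tauto
  have hset : (J.filter (fun x => x < j)).filter (fun p =>
      D.filter (fun d => p < d ∧ d < j) ⊆ (J.filter (fun x => x < j)).filter (fun x => p < x) ∧
        (J.filter (fun x => x < j)).filter (fun x => p < x) ∩ U = ∅) =
      D.filter (fun d => i < d ∧ d < j) ∪ (if i ∈ U then {i} else ∅) := by
    ext p
    simp only [Finset.mem_filter, Finset.mem_union, Finset.eq_empty_iff_forall_notMem,
      Finset.subset_iff, Finset.mem_inter]
    have hone : p ∈ (if i ∈ U then {i} else (∅ : Finset ℕ)) ↔ i ∈ U ∧ p = i := by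
      split_ifs with hu <;> simp [hu]
    rw [hone]
    constructor
    · rintro ⟨⟨hpJ, hpj⟩, h1, h2⟩
      have hpb := Finset.mem_Icc.1 (hJ hpJ)
      rcases lt_trichotomy p i with h3 | h3 | h3
      · exfalso
        rcases hib with h4 | h4 | h4 | h4
        · omega
        · omega
        · exact h4.2 (h1 ⟨h4.1, h3, hij⟩).1.1
        · exact h2 i ⟨⟨⟨h4.2, hij⟩, h3⟩, h4.1⟩
      · subst h3
        rcases hib with h4 | h4 | h4 | h4
        · omega
        · omega
        · exact absurd hpJ h4.2
        · exact Or.inr ⟨h4.1, rfl⟩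
      · exact Or.inl ⟨(key p (hJ hpJ) h3 hpj).1.1 hpJ, h3, hpj⟩
    · intro hp
      have hp' : p ∈ J ∧ i ≤ p ∧ p < j := by
        rcases hp with ⟨h1, h2, h3⟩ | ⟨h1, rfl⟩
        · exact ⟨(key p (Finset.mem_Icc.2 (h.bounds_down h1)) h2 h3).1.2 h1, h2.le, h3⟩
        · refine ⟨?_, le_rfl, hij⟩
          have := h.bounds_up h1
          rcases hib with h4 | h4 | h4 | h4
          · omega
          · omega
          · exact absurd h1 (h.not_mem_up h4.1)
          · exact h4.2
      refine ⟨⟨hp'.1, hp'.2.2⟩, fun d hd => ?_, fun x hx => ?_⟩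
      · exact ⟨⟨(key d (Finset.mem_Icc.2 (h.bounds_down hd.1)) (by omega) hd.2.2).1.2 hd.1,
          hd.2.2⟩, hd.2.1⟩
      · exact (key x (hJ hx.1.1.1) (by omega) hx.1.1.2).2 hx.1.1.1 hx.2
  rw [hset, Finset.sum_union]
  · congr 1
    · rw [Finset.card_eq_sum_ones, Nat.cast_sum]
      exact Finset.sum_congr rfl fun d hd => by simp [(Finset.mem_filter.1 hd).1]
    · split_ifs with hu
      · rw [Finset.sum_singleton, if_neg (fun hd => h.not_mem_up hd hu)]
      · rfl
  · rw [Finset.disjoint_left]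
    intro x hx hx'
    have := (Finset.mem_filter.1 hx).2
    split_ifs at hx'
    · rw [Finset.mem_singleton] at hx'
      omega
    · simp at hx'

lemma sum_rightWeight (h : IsUpDown n D U) (hJ : J ⊆ Finset.Icc 1 (n + 1)) {j k : ℕ}
    (hj : j ∈ Finset.Icc 1 (n + 1)) (hk : IsNext n D U J j k) :
    ∑ A ∈ (J.filter (fun x => j < x)).powerset, rightWeight n D U j A =
      (D.filter (fun d => j < d ∧ d < k)).card + if k ∈ U then (n : ℝ) + 2 - k else 0 := by
  rw [h.sum_rightWeight_powerset j _ ((Finset.filter_subset _ _).trans hJ)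
    (fun x hx => (Finset.mem_filter.1 hx).2)]
  simp only [mul_ite, mul_one, mul_zero]
  rw [← Finset.sum_filter]
  obtain ⟨hib, hij, hmin⟩ := hk
  rw [Finset.mem_Icc] at hj
  rw [mem_blockers] at hib
  have key : ∀ c, c ∈ Finset.Icc 1 (n + 1) → j < c → c < k → (c ∈ J ↔ c ∈ D) ∧ (c ∈ J → c ∉ U) := by
    intro c hc h1 h2
    have := hmin c
    rw [mem_blockers] at this
    have h3 : ¬ ((c ∈ D ∧ c ∉ J) ∨ (c ∈ U ∧ c ∈ J)) := fun h4 => by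
      have := this (Or.inr (Or.inr h4)) h1
      omega
    have h5 := h.mem_or.2 (Finset.mem_Icc.1 hc)
    have h6 : c ∈ D → c ∉ U := h.not_mem_up
    tauto
  have hset : (J.filter (fun x => j < x)).filter (fun p =>
      D.filter (fun d => j < d ∧ d < p) ⊆ (J.filter (fun x => j < x)).filter (fun x => x < p) ∧
        (J.filter (fun x => j < x)).filter (fun x => x < p) ∩ U = ∅) =
      D.filter (fun d => j < d ∧ d < k) ∪ (if k ∈ U then {k} else ∅) := by
    ext p
    simp only [Finset.mem_filter, Finset.mem_union, Finset.eq_empty_iff_forall_notMem,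
      Finset.subset_iff, Finset.mem_inter]
    have hone : p ∈ (if k ∈ U then {k} else (∅ : Finset ℕ)) ↔ k ∈ U ∧ p = k := by
      split_ifs with hu <;> simp [hu]
    rw [hone]
    constructor
    · rintro ⟨⟨hpJ, hpj⟩, h1, h2⟩
      have hpb := Finset.mem_Icc.1 (hJ hpJ)
      rcases lt_trichotomy k p with h3 | h3 | h3
      · exfalso
        rcases hib with h4 | h4 | h4 | h4
        · omega
        · omega
        · exact h4.2 (h1 ⟨h4.1, hij, h3⟩).1.1
        · exact h2 k ⟨⟨⟨h4.2, hij⟩, h3⟩, h4.1⟩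
      · subst h3
        rcases hib with h4 | h4 | h4 | h4
        · omega
        · omega
        · exact absurd hpJ h4.2
        · exact Or.inr ⟨h4.1, rfl⟩
      · exact Or.inl ⟨(key p (hJ hpJ) hpj h3).1.1 hpJ, hpj, h3⟩
    · intro hp
      have hp' : p ∈ J ∧ j < p ∧ p ≤ k := by
        rcases hp with ⟨h1, h2, h3⟩ | ⟨h1, rfl⟩
        · exact ⟨(key p (Finset.mem_Icc.2 (h.bounds_down h1)) h2 h3).1.2 h1, h2, h3.le⟩
        · refine ⟨?_, hij, le_rfl⟩
          have := h.bounds_up h1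
          rcases hib with h4 | h4 | h4 | h4
          · omega
          · omega
          · exact absurd h1 (h.not_mem_up h4.1)
          · exact h4.2
      refine ⟨⟨hp'.1, hp'.2.1⟩, fun d hd => ?_, fun x hx => ?_⟩
      · exact ⟨⟨(key d (Finset.mem_Icc.2 (h.bounds_down hd.1)) hd.2.1 (by omega)).1.2 hd.1,
          hd.2.1⟩, hd.2.2⟩
      · exact (key x (hJ hx.1.1.1) hx.1.1.2 (by omega)).2 hx.1.1.1 hx.2
  rw [hset, Finset.sum_union]
  · congr 1
    · rw [Finset.card_eq_sum_ones, Nat.cast_sum]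
      exact Finset.sum_congr rfl fun d hd => by simp [(Finset.mem_filter.1 hd).1]
    · split_ifs with hu
      · rw [Finset.sum_singleton, if_neg (fun hd => h.not_mem_up hd hu)]
      · rfl
  · rw [Finset.disjoint_left]
    intro x hx hx'
    have := (Finset.mem_filter.1 hx).2
    split_ifs at hx'
    · rw [Finset.mem_singleton] at hx'
      omega
    · simp at hx'

end IsUpDown

lemma sum_powerset_split {J : Finset ℕ} {j : ℕ} (hj : j ∉ J) (f : Finset ℕ → ℝ) :
    ∑ I ∈ J.powerset, f I = ∑ A ∈ (J.filter (fun x => x < j)).powerset,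
      ∑ B ∈ (J.filter (fun x => j < x)).powerset, f (A ∪ B) := by
  rw [← Finset.sum_product']
  refine Finset.sum_nbij' (fun I => (I.filter (fun x => x < j), I.filter (fun x => j < x)))
    (fun p => p.1 ∪ p.2) ?_ ?_ ?_ ?_ ?_
  · intro I hI
    rw [Finset.mem_powerset] at hI
    exact Finset.mem_product.2 ⟨Finset.mem_powerset.2 (Finset.filter_subset_filter _ hI),
      Finset.mem_powerset.2 (Finset.filter_subset_filter _ hI)⟩
  · intro p hp
    rw [Finset.mem_product, Finset.mem_powerset, Finset.mem_powerset] at hp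
    exact Finset.mem_powerset.2 (Finset.union_subset (hp.1.trans (Finset.filter_subset _ _))
      (hp.2.trans (Finset.filter_subset _ _)))
  · intro I hI
    rw [Finset.mem_powerset] at hI
    ext x
    simp only [Finset.mem_union, Finset.mem_filter]
    constructor
    · rintro (h1 | h1) <;> exact h1.1
    · intro hx
      have : x ≠ j := fun hxj => hj (hxj ▸ hI hx)
      rcases lt_or_gt_of_ne this with h1 | h1
      · exact Or.inl ⟨hx, h1⟩
      · exact Or.inr ⟨hx, h1⟩
  · rintro ⟨A, B⟩ hp
    simp only [Finset.mem_product, Finset.mem_powerset] at hp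
    have h1 : ∀ x ∈ A, x < j := fun x hx => (Finset.mem_filter.1 (hp.1 hx)).2
    have h2 : ∀ x ∈ B, j < x := fun x hx => (Finset.mem_filter.1 (hp.2 hx)).2
    refine Prod.ext ?_ ?_
    · ext x
      simp only [Finset.mem_filter, Finset.mem_union]
      constructor
      · rintro ⟨h3 | h3, h4⟩
        · exact h3
        · have := h2 x h3; omega
      · exact fun hx => ⟨Or.inl hx, h1 x hx⟩
    · ext x
      simp only [Finset.mem_filter, Finset.mem_union]
      constructor
      · rintro ⟨h3 | h3, h4⟩
        · have := h1 x h3; omega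
        · exact h3
      · exact fun hx => ⟨Or.inr hx, h2 x hx⟩
  · intro I hI
    rw [Finset.mem_powerset] at hI
    congr 1
    ext x
    simp only [Finset.mem_union, Finset.mem_filter]
    constructor
    · intro hx
      have : x ≠ j := fun hxj => hj (hxj ▸ hI hx)
      rcases lt_or_gt_of_ne this with h1 | h1
      · exact Or.inl ⟨hx, h1⟩
      · exact Or.inr ⟨hx, h1⟩
    · rintro (h1 | h1) <;> exact h1.1

/-- The sum of the dilation factors of the subsets of `J`. -/
def total (n : ℕ) (D U J : Finset ℕ) : ℝ := ∑ I ∈ J.powerset, yI n D U I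

lemma yI_empty (n : ℕ) (D U : Finset ℕ) : yI n D U ∅ = 0 :=
  if_pos fun hb => Finset.not_nonempty_empty hb.1

lemma total_empty (n : ℕ) (D U : Finset ℕ) : total n D U ∅ = 0 := by
  simp [total, yI_empty]

/-- Adding the label `j` to `J` increases the sum of the dilation factors by the value of the
triangle formed by `j` and its neighbouring blockers. -/
lemma IsUpDown.total_insert {n : ℕ} {D U J : Finset ℕ} (h : IsUpDown n D U)
    (hJ : J ⊆ Finset.Icc 1 (n + 1)) {i j k : ℕ} (hj : j ∈ Finset.Icc 1 (n + 1)) (hjJ : j ∉ J)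
    (hi : IsPrev n D U J j i) (hk : IsNext n D U J j k) :
    total n D U (insert j J) = total n D U J + gain n D U i j k := by
  rw [total, Finset.sum_powerset_insert hjJ, total, add_right_inj,
    sum_powerset_split hjJ (fun I => yI n D U (insert j I))]
  have hone : ∀ M : Finset ℕ, ∑ A ∈ M.powerset, (if A = ∅ then (1 : ℝ) else 0) = 1 := fun M => by
    rw [Finset.sum_ite_eq' M.powerset ∅ (fun _ => (1 : ℝ)), if_pos (Finset.empty_mem_powerset M)]
  have hL := h.sum_leftWeight hJ hj hi
  have hR := h.sum_rightWeight hJ hj hk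
  have hjb := Finset.mem_Icc.1 hj
  have hkb := h.le_of_mem_blockers hk.1
  have hkc : ((if k ∈ U then n + 2 - k else 0 : ℕ) : ℝ) = if k ∈ U then (n : ℝ) + 2 - k else 0 := by
    split_ifs
    · rw [Nat.cast_sub hkb]; push_cast; ring
    · simp
  have b1 := congrArg (fun m : ℕ => (m : ℝ)) (h.bel_eq hi.2.1 (by omega : j ≤ n + 2))
  have b2 := congrArg (fun m : ℕ => (m : ℝ)) (h.bel_eq hk.2.1 hkb)
  simp only [Nat.cast_add, hkc] at b1 b2
  have hyI : ∀ A ∈ (J.filter (fun x => x < j)).powerset,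
      ∀ B ∈ (J.filter (fun x => j < x)).powerset, _ := fun A hA B hB =>
    h.yI_insert (A := A) (B := B)
      (((Finset.mem_powerset.1 hA).trans (Finset.filter_subset _ _)).trans hJ)
      (((Finset.mem_powerset.1 hB).trans (Finset.filter_subset _ _)).trans hJ) hj
      (fun x hx => (Finset.mem_filter.1 (Finset.mem_powerset.1 hA hx)).2)
      (fun x hx => (Finset.mem_filter.1 (Finset.mem_powerset.1 hB hx)).2)
  rw [Finset.sum_congr rfl fun A hA => Finset.sum_congr rfl (hyI A hA)]
  by_cases hd : j ∈ D
  · have hu := h.not_mem_up hd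
    simp only [hd, if_true]
    rw [← Finset.sum_mul_sum, Finset.sum_add_distrib, Finset.sum_add_distrib, hone, hone, hL, hR,
      gain, if_pos hd, b1, b2]
    simp only [hu, if_false, Nat.cast_zero, Nat.cast_ite]
    ring
  · have hu : j ∈ U := (h.mem_or.2 hjb).resolve_left hd
    simp only [hd, if_false, Finset.sum_sub_distrib]
    rw [← Finset.sum_mul_sum]
    simp only [← Finset.mul_sum]
    rw [Finset.sum_sub_distrib, Finset.sum_sub_distrib, ← Finset.mul_sum, ← Finset.mul_sum]
    simp only [hone, hL, hR, mul_one]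
    rw [gain, if_neg hd, b1, b2]
    simp only [hu, if_true, Nat.cast_zero, Nat.cast_ite]
    rw [Nat.cast_sub (by omega : j ≤ n + 2)]
    push_cast
    ring

/-- The monotone path through the blockers of `J` consists of edges of `T`. -/
def Admissible (n : ℕ) (D U : Finset ℕ) (T : Finset (ℕ × ℕ)) (J : Finset ℕ) : Prop :=
  ∀ a b, a ∈ blockers n D U J → IsNext n D U J a b → EdgeOf n D U T a b

section Path

variable {n : ℕ} {D U J : Finset ℕ} {T : Finset (ℕ × ℕ)}

lemma mem_blockers_erase {j v : ℕ} (hv : v ≠ j) :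
    v ∈ blockers n D U (J.erase j) ↔ v ∈ blockers n D U J := by
  simp [mem_blockers, Finset.mem_erase, hv]

lemma IsPrev.erase {i j : ℕ} (hi : IsPrev n D U J j i) : IsPrev n D U (J.erase j) j i :=
  ⟨(mem_blockers_erase hi.2.1.ne).2 hi.1, hi.2.1,
    fun c hc hcj => hi.2.2 c ((mem_blockers_erase hcj.ne).1 hc) hcj⟩

lemma IsNext.erase {j k : ℕ} (hk : IsNext n D U J j k) : IsNext n D U (J.erase j) j k :=
  ⟨(mem_blockers_erase hk.2.1.ne').2 hk.1, hk.2.1,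
    fun c hc hcj => hk.2.2 c ((mem_blockers_erase hcj.ne').1 hc) hcj⟩

/-- The path stays admissible when it is pushed across a triangle. -/
lemma Admissible.erase (hA : Admissible n D U T J) {i j k : ℕ} (ht : IsTriangleOf n D U T i j k)
    (hi : IsPrev n D U J j i) (hk : IsNext n D U J j k) : Admissible n D U T (J.erase j) := by
  intro x y hx hy
  have hi' := hi.erase
  have hk' := hk.erase
  obtain ⟨-, -, -, eij, ejk, eik⟩ := ht
  have uk : x < k → y ≤ k := hy.2.2 k hk'.1
  have ui : x < i → y ≤ i := hy.2.2 i hi'.1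
  have vi : x < j → x ≤ i := hi'.2.2 x hx
  have vk : j < y → k ≤ y := hk'.2.2 y hy.1
  have hij := hi.2.1
  have hjk := hk.2.1
  have hxy := hy.2.1
  by_cases hxj : x = j
  · obtain rfl : y = k := by omega
    rwa [hxj]
  by_cases hyj : y = j
  · obtain rfl : x = i := by omega
    rwa [hyj]
  by_cases hc : x < j ∧ j < y
  · obtain rfl : x = i := by omega
    obtain rfl : y = k := by omega
    exact eik
  · refine hA x y ((mem_blockers_erase hxj).1 hx)
      ⟨(mem_blockers_erase hyj).1 hy.1, hxy, fun c hcb hxc => ?_⟩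
    by_cases hcj : c = j
    · omega
    · exact hy.2.2 c ((mem_blockers_erase hcj).2 hcb) hxc

lemma IsPrev.isNext {a b : ℕ} (ha : IsPrev n D U J b a) (hb : b ∈ blockers n D U J) :
    IsNext n D U J a b :=
  ⟨hb, ha.2.1, fun c hc hac => by
    by_contra hcb
    have := ha.2.2 c hc (by omega)
    omega⟩

/-- Some triangle of `T` below an admissible path has all its neighbours on the path. -/
lemma IsTriangulation.exists_flip (hT : IsTriangulation n D U T) (h : IsUpDown n D U)
    (hJ : J ⊆ Finset.Icc 1 (n + 1)) (hne : J.Nonempty) (hA : Admissible n D U T J) :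
    ∃ j ∈ J, ∃ i k, IsTriangleOf n D U T i j k ∧ IsPrev n D U J j i ∧ IsNext n D U J j k := by
  by_cases hmid : ∃ a b c, a ∈ blockers n D U J ∧ IsNext n D U J a b ∧ c ∉ U ∧ a < c ∧ c < b ∧
      Joined n D U T a c ∧ Joined n D U T c b
  · obtain ⟨a, b, c, ha, hb, hcU, hac, hcb, jac, jcb⟩ := hmid
    have hb2 := h.le_of_mem_blockers hb.1
    have hcD : c ∈ D := h.mem_down (by omega) (by omega) hcU
    have hcJ : c ∈ J := by
      by_contra hcJ
      have := hb.2.2 c (mem_blockers.2 (Or.inr (Or.inr (Or.inl ⟨hcD, hcJ⟩)))) hac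
      omega
    refine ⟨c, hcJ, a, b, ⟨hac, hcb, hb2, hT.edgeOf_of_joined jac hac,
      hT.edgeOf_of_joined jcb hcb, hA a b ha hb⟩, ⟨ha, hac, fun x hx hxc => ?_⟩,
      ⟨hb.1, hcb, fun x hx hcx => hb.2.2 x hx (hac.trans hcx)⟩⟩
    by_contra hxa
    have := hb.2.2 x hx (by omega)
    omega
  have third : ∀ a b v, a ∈ blockers n D U J → IsNext n D U J a b → StrictBetween n D U a b v →
      ∃ c, ((a ∈ U ∧ c < a) ∨ (b ∈ U ∧ b < c)) ∧ Joined n D U T a c ∧ Joined n D U T c b := by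
    intro a b v ha hb hv
    obtain ⟨c, hc, j1, j2⟩ := hT.exists_third_vertex h (Or.inl (hA a b ha hb)) hv
    rw [h.strictBetween_iff hb.2.1 (h.le_of_mem_blockers hb.1) hc.1] at hc
    rcases hc with hc | hc
    · exact absurd ⟨a, b, c, ha, hb, hc.1, hc.2.1, hc.2.2, j1, j2⟩ hmid
    · exact ⟨c, hc, j1, j2⟩
  have upJ : ∀ v ∈ blockers n D U J, v ∈ U → v ∈ J := by
    intro v hv hvU
    have := h.bounds_up hvU
    rcases mem_blockers.1 hv with h1 | h1 | h1 | h1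
    · omega
    · omega
    · exact absurd hvU (h.not_mem_up h1.1)
    · exact h1.2
  by_cases hUJ : (U ∩ J).Nonempty
  · have hbl : ∀ {b}, b ∈ U ∩ J → b ∈ blockers n D U J := fun hb =>
      mem_blockers.2 (Or.inr (Or.inr (Or.inr (Finset.mem_inter.1 hb))))
    let S := (U ∩ J).filter
      (fun b => ∃ k c, IsNext n D U J b k ∧ c < b ∧ Joined n D U T b c ∧ Joined n D U T c k)
    have hS : S.Nonempty := by
      obtain ⟨m, hm, hmax⟩ := Finset.exists_max_image (U ∩ J) id hUJ
      have hmU := (Finset.mem_inter.1 hm).1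
      have hmb := h.bounds_up hmU
      obtain ⟨k, hk⟩ := exists_isNext (n := n) (D := D) (U := U) (J := J) (j := m) (by omega)
      have hkU : k ∉ U := fun hkU => by
        have h1 := hmax k (Finset.mem_inter.2 ⟨hkU, upJ k hk.1 hkU⟩)
        have h2 := hk.2.1
        simp only [id] at h1
        omega
      obtain ⟨c, hc, j1, j2⟩ := third m k 0 (hbl hm) hk
        ((h.strictBetween_iff hk.2.1 (h.le_of_mem_blockers hk.1) (Nat.zero_le _)).2
          (Or.inr (Or.inl ⟨hmU, by omega⟩)))
      exact ⟨m, Finset.mem_filter.2 ⟨hm, k, c, hk, by tauto, j1, j2⟩⟩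
    obtain ⟨b, hb, hmin⟩ := Finset.exists_min_image S id hS
    obtain ⟨hbUJ, k, c, hk, hcb, jbc, jck⟩ := Finset.mem_filter.1 hb
    obtain ⟨hbU, hbJ⟩ := Finset.mem_inter.1 hbUJ
    have hbb := h.bounds_up hbU
    obtain ⟨a, ha⟩ := exists_isPrev (n := n) (D := D) (U := U) (J := J) (j := b) (by omega)
    have hab := ha.isNext (hbl hbUJ)
    obtain ⟨c', hc', j1, j2⟩ := third a b (n + 2) ha.1 hab
      ((h.strictBetween_iff ha.2.1 (by omega) le_rfl).2 (Or.inr (Or.inr ⟨hbU, by omega⟩)))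
    have hbc' : b < c' := by
      rcases hc' with hc' | hc'
      · have h1 := hmin a (Finset.mem_filter.2 ⟨Finset.mem_inter.2 ⟨hc'.1, upJ a ha.1 hc'.1⟩,
          b, c', hab, hc'.2, j1, j2⟩)
        have h2 := ha.2.1
        simp only [id] at h1
        omega
      · exact hc'.2
    have t1 : IsTriangleOf n D U T a b c' :=
      ⟨ha.2.1, hbc', (hT.bounds_of_joined j1).2.2, hA a b ha.1 hab,
        hT.edgeOf_of_joined j2.symm hbc', hT.edgeOf_of_joined j1 (ha.2.1.trans hbc')⟩
    have t2 : IsTriangleOf n D U T c b k :=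
      ⟨hcb, hk.2.1, h.le_of_mem_blockers hk.1, hT.edgeOf_of_joined jbc.symm hcb,
        hA b k (hbl hbUJ) hk, hT.edgeOf_of_joined jck (hcb.trans hk.2.1)⟩
    obtain ⟨-, rfl⟩ := hT.triangle_unique h t1 t2
    exact ⟨b, hbJ, a, c', t1, ha, hk⟩
  · exfalso
    have hnU : ∀ v ∈ J, v ∉ U := fun v hv hvU => hUJ ⟨v, Finset.mem_inter.2 ⟨hvU, hv⟩⟩
    obtain ⟨j, hj⟩ := hne
    have hjb := Finset.mem_Icc.1 (hJ hj)
    have hjD := h.mem_down hjb.1 hjb.2 (hnU j hj)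
    obtain ⟨a, ha⟩ := exists_isPrev (n := n) (D := D) (U := U) (J := J) (j := j) (by omega)
    obtain ⟨b, hb⟩ := exists_isNext (n := n) (D := D) (U := U) (J := J) (j := j) (by omega)
    have hjn : j ∉ blockers n D U J := fun hm => by
      rcases mem_blockers.1 hm with h1 | h1 | h1 | h1
      · omega
      · omega
      · exact h1.2 hj
      · exact hnU j hj h1.1
    have hab : IsNext n D U J a b := ⟨hb.1, ha.2.1.trans hb.2.1, fun c hc hac => by
      rcases lt_trichotomy c j with h1 | h1 | h1
      · have := ha.2.2 c hc h1
        omega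
      · exact absurd (h1 ▸ hc) hjn
      · exact hb.2.2 c hc h1⟩
    obtain ⟨c, hc, -⟩ := third a b j ha.1 hab
      ((h.strictBetween_iff hab.2.1 (h.le_of_mem_blockers hb.1) (by omega)).2
        (Or.inl ⟨hnU j hj, ha.2.1, hb.2.1⟩))
    rcases hc with hc | hc
    · exact hnU a (upJ a ha.1 hc.1) hc.1
    · exact hnU b (upJ b hb.1 hc.1) hc.1

/-- For an admissible `J`, the sum of the coordinates of `x(T)` over `J` is the sum of the dilation
factors, and it bounds the sums of the dilation factors over subsets of `J`. -/
lemma IsTriangulation.total_eq_and_le (hT : IsTriangulation n D U T) (h : IsUpDown n D U)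
    (hJ : J ⊆ Finset.Icc 1 (n + 1)) (hA : Admissible n D U T J) :
    total n D U J = ∑ j ∈ J, xcoord n D U T j ∧
      ∀ K ⊆ J, total n D U K ≤ ∑ j ∈ K, xcoord n D U T j := by
  induction J using Finset.strongInduction with
  | H J ih =>
    rcases J.eq_empty_or_nonempty with rfl | hne
    · refine ⟨by simp [total_empty], fun K hK => ?_⟩
      rw [Finset.subset_empty.1 hK]
      simp [total_empty]
    obtain ⟨j, hj, i, k, ht, hi, hk⟩ := hT.exists_flip h hJ hne hA
    obtain ⟨ih1, ih2⟩ := ih (J.erase j) (Finset.erase_ssubset hj)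
      ((Finset.erase_subset _ _).trans hJ) (hA.erase ht hi hk)
    have hjI := hJ hj
    have hjb := Finset.mem_Icc.1 hjI
    have hx := hT.xcoord_eq h ht
    constructor
    · have := h.total_insert ((Finset.erase_subset _ _).trans hJ) hjI (Finset.notMem_erase j J)
        hi.erase hk.erase
      rw [Finset.insert_erase hj] at this
      rw [this, ih1, ← Finset.sum_erase_add _ _ hj, hx]
    · intro K hK
      by_cases hjK : j ∈ K
      · have hKJ : K.erase j ⊆ J.erase j := Finset.erase_subset_erase j hK
        obtain ⟨i', hi'⟩ := exists_isPrev (n := n) (D := D) (U := U) (J := K.erase j) (j := j)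
          (by omega)
        obtain ⟨k', hk'⟩ := exists_isNext (n := n) (D := D) (U := U) (J := K.erase j) (j := j)
          (by omega)
        have h1 := h.total_insert (((Finset.erase_subset _ _).trans hK).trans hJ) hjI
          (Finset.notMem_erase j K) hi' hk'
        rw [Finset.insert_erase hjK] at h1
        rw [h1, ← Finset.sum_erase_add _ _ hjK, hx]
        exact add_le_add (ih2 _ hKJ)
          (h.gain_mono hKJ (by omega) hi' hk' hi.erase hk.erase)
      · exact ih2 K (Finset.subset_erase.2 ⟨hK, hjK⟩)

lemma IsUpDown.admissible_univ (h : IsUpDown n D U) :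
    Admissible n D U T (Finset.Icc 1 (n + 1)) := by
  intro a b ha hb
  have hb2 := h.le_of_mem_blockers hb.1
  have hab := hb.2.1
  have key : ∀ v ∈ blockers n D U (Finset.Icc 1 (n + 1)), v = 0 ∨ v = n + 2 ∨ v ∈ U := by
    intro v hv
    rcases mem_blockers.1 hv with h1 | h1 | h1 | h1
    · exact Or.inl h1
    · exact Or.inr (Or.inl h1)
    · exact absurd (Finset.mem_Icc.2 (h.bounds_down h1.1)) h1.2
    · exact Or.inr (Or.inr h1.1)
  have ha' := key a ha
  have hb' := key b hb.1
  refine Or.inr ⟨⟨hab, hb2⟩, Or.inr ((h.relpos_eq_one_iff hb2 (by omega) hab.ne').2 ?_)⟩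
  intro v hv hv'
  rw [h.strictBetween_swap (by omega) hb2 hv hab.ne, h.strictBetween_iff hab hb2 hv] at hv'
  obtain ⟨h1, h2, h3⟩ := hv'
  apply h3
  rcases lt_or_gt_of_ne h1 with h4 | h4
  · exact Or.inr (Or.inl ⟨by
      rcases ha' with h5 | h5 | h5
      · omega
      · omega
      · exact h5, h4⟩)
  rcases lt_or_gt_of_ne h2 with h5 | h5
  · refine Or.inl ⟨fun hvU => ?_, h4, h5⟩
    have := hb.2.2 v (mem_blockers.2 (Or.inr (Or.inr (Or.inr
      ⟨hvU, Finset.mem_Icc.2 (h.bounds_up hvU)⟩)))) h4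
    omega
  · exact Or.inr (Or.inr ⟨by
      rcases hb' with h6 | h6 | h6
      · omega
      · omega
      · exact h6, h5⟩)

lemma IsUpDown.cross_symm (h : IsUpDown n D U) {δ δ' : ℕ × ℕ} (hδ : IsDiag n δ)
    (hδ' : IsDiag n δ') (hc : Cross n D U δ δ') : Cross n D U δ' δ := by
  obtain ⟨a, b⟩ := δ
  obtain ⟨c, d⟩ := δ'
  obtain ⟨hab, hb⟩ := hδ
  obtain ⟨hcd, hd⟩ := hδ'
  simp only at hab hb hcd hd
  have ha : a ≤ n + 2 := by omega
  have hc' : c ≤ n + 2 := by omega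
  obtain ⟨n1, n2, n3, n4, n5, n6, hx⟩ := hc
  refine ⟨n2, n1, n3.symm, n5.symm, n4.symm, n6.symm, ?_⟩
  simp only at hx ⊢
  rw [h.strictBetween_iff_pos ha hb hc', h.strictBetween_iff_pos hb ha hd,
    h.strictBetween_iff_pos ha hb hd, h.strictBetween_iff_pos hb ha hc'] at hx
  rw [h.strictBetween_iff_pos hc' hd ha, h.strictBetween_iff_pos hd hc' hb,
    h.strictBetween_iff_pos hc' hd hb, h.strictBetween_iff_pos hd hc' ha]
  omega

/-- A set of pairwise non-crossing internal diagonals extends to a triangulation. -/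
lemma IsUpDown.exists_isTriangulation_of_not_cross (h : IsUpDown n D U) {S : Finset (ℕ × ℕ)}
    (hS : ∀ δ ∈ S, IsInternalDiag n D U δ)
    (hS' : ∀ δ ∈ S, ∀ δ' ∈ S, ¬ Cross n D U δ δ') :
    ∃ T, IsTriangulation n D U T ∧ S ⊆ T := by
  let W := (Finset.range (n + 3) ×ˢ Finset.range (n + 3)).filter
    (fun δ => IsInternalDiag n D U δ)
  have hW : ∀ δ, δ ∈ W ↔ IsInternalDiag n D U δ := fun δ => by
    refine ⟨fun hm => (Finset.mem_filter.1 hm).2, fun hm => Finset.mem_filter.2 ⟨?_, hm⟩⟩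
    have := hm.1.1
    have := hm.1.2
    exact Finset.mem_product.2 ⟨Finset.mem_range.2 (by omega), Finset.mem_range.2 (by omega)⟩
  obtain ⟨T, hT, hmax⟩ := Finset.exists_max_image
    (W.powerset.filter (fun T => S ⊆ T ∧ ∀ δ ∈ T, ∀ δ' ∈ T, ¬ Cross n D U δ δ')) Finset.card
    ⟨S, Finset.mem_filter.2 ⟨Finset.mem_powerset.2 fun δ hδ => (hW δ).2 (hS δ hδ),
      Finset.Subset.refl _, hS'⟩⟩
  obtain ⟨hTW, hST, hTc⟩ := Finset.mem_filter.1 hT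
  rw [Finset.mem_powerset] at hTW
  refine ⟨T, ⟨fun δ hδ => (hW δ).1 (hTW hδ), hTc, fun δ hδ hδT => ?_⟩, hST⟩
  by_contra! hcon
  have hnot : ∀ δ' ∈ T, ¬ Cross n D U δ' δ := fun δ' hδ' hc =>
    hcon δ' hδ' (h.cross_symm ((hW δ').1 (hTW hδ')).1 hδ.1 hc)
  have := hmax (insert δ T) (Finset.mem_filter.2 ⟨Finset.mem_powerset.2
    (Finset.insert_subset ((hW δ).2 hδ) hTW), hST.trans (Finset.subset_insert _ _), ?_⟩)
  · rw [Finset.card_insert_of_notMem hδT] at this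
    omega
  · intro x hx y hy
    rcases Finset.mem_insert.1 hx with rfl | hxT <;> rcases Finset.mem_insert.1 hy with rfl | hyT
    · exact fun hc => hc.2.2.1 rfl
    · exact hcon y hyT
    · exact hnot x hxT
    · exact hTc x hxT y hyT

lemma IsUpDown.exists_admissible (h : IsUpDown n D U) (J : Finset ℕ) :
    ∃ T, IsTriangulation n D U T ∧ Admissible n D U T J := by
  let S := (Finset.range (n + 3) ×ˢ Finset.range (n + 3)).filter
    (fun δ => IsInternalDiag n D U δ ∧ δ.1 ∈ blockers n D U J ∧ IsNext n D U J δ.1 δ.2)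
  obtain ⟨T, hT, hST⟩ := h.exists_isTriangulation_of_not_cross (S := S)
    (fun δ hδ => (Finset.mem_filter.1 hδ).2.1) (by
      rintro ⟨a, b⟩ hab ⟨c, d⟩ hcd ⟨-, -, n3, n4, n5, n6, hx⟩
      obtain ⟨-, hd1, ha, hb⟩ := Finset.mem_filter.1 hab
      obtain ⟨-, hd2, hc, hd⟩ := Finset.mem_filter.1 hcd
      obtain ⟨hlt, hb2⟩ := hd1.1
      obtain ⟨hlt', hd2⟩ := hd2.1
      simp only at n3 n4 n5 n6 hx ha hb hc hd hlt hb2 hlt' hd2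
      have h1 := hb.2.2 c hc
      have h2 := hd.2.2 a ha
      rw [h.strictBetween_swap (by omega) hb2 hd2 hlt.ne,
        h.strictBetween_swap (by omega) hb2 (by omega) hlt.ne,
        h.strictBetween_iff hlt hb2 hd2, h.strictBetween_iff hlt hb2 (by omega)] at hx
      rcases lt_or_gt_of_ne n3 with h3 | h3
      · have e1 : b < c := by omega
        have e2 : b < d := by omega
        simp only [e1, e2, not_lt_of_gt e1, not_lt_of_gt e2, not_lt_of_gt (hlt.trans e1),
          not_lt_of_gt (hlt.trans e2), and_false, and_true, false_or] at hx
        tauto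
      · have e1 : d < a := by omega
        have e2 : c < a := by omega
        simp only [e1, e2, not_lt_of_gt e1, not_lt_of_gt e2, not_lt_of_gt (e1.trans hlt),
          not_lt_of_gt (e2.trans hlt), and_false, false_and, and_true, false_or, or_false] at hx
        tauto)
  refine ⟨T, hT, fun a b ha hb => ?_⟩
  have hb2 := h.le_of_mem_blockers hb.1
  have hab := hb.2.1
  by_cases hB : IsBoundaryEdge n D U (a, b)
  · exact Or.inr hB
  · exact Or.inl (hST (Finset.mem_filter.2 ⟨Finset.mem_product.2
      ⟨Finset.mem_range.2 (by simp only; omega), Finset.mem_range.2 (by simp only; omega)⟩,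
      ⟨⟨hab, hb2⟩, hB⟩, ha, hb⟩))

end Path

/-- For every nonempty `J ⊆ [n+1]`, the sum `∑_{∅≠I⊆J} y_I` equals
`z_J`, the minimum of `∑_{j∈J} x_j(T)` over all triangulations `T` of `P`. -/
theorem minkowski_dilation_factors (n : ℕ) (hn : 1 ≤ n) (D U : Finset ℕ)
    (hUD : D ∪ U = Finset.Icc 1 (n + 1)) (hdisj : Disjoint D U)
    (J : Finset ℕ) (hJ : J ⊆ Finset.Icc 1 (n + 1)) (hJne : J.Nonempty) :
    IsLeast {s : ℝ | ∃ T : Finset (ℕ × ℕ), IsTriangulation n D U T ∧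
        s = ∑ j ∈ J, xcoord n D U T j}
      (∑ I ∈ J.powerset.filter (fun I => I.Nonempty), yI n D U I) := by
  have h : IsUpDown n D U := ⟨hUD, hdisj⟩
  have hsum : ∑ I ∈ J.powerset.filter (fun I => I.Nonempty), yI n D U I = total n D U J := by
    refine Finset.sum_filter_of_ne fun I _ hI => ?_
    rw [Finset.nonempty_iff_ne_empty]
    rintro rfl
    exact hI (yI_empty n D U)
  rw [hsum]
  constructor
  · obtain ⟨T, hT, hA⟩ := h.exists_admissible J
    exact ⟨T, hT, (hT.total_eq_and_le h hJ hA).1⟩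
  · rintro s ⟨T, hT, rfl⟩
    exact (hT.total_eq_and_le h (Finset.Subset.refl _) h.admissible_univ).2 J hJ

end Spines
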